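/- Let N ≥ 1, m > 1, q ∈ (0,1) and 0 < σ < 2(1−q)/(m−1). Let u_0 ∈ L^∞(ℝ^N) be non-negative and let u be a non-negative weak solution of ∂_t u = Δ(u^m) − |x|^σ u^q with u(0) = u_0. Assume that the support of u is localized, i.e. there exists R > 0 such that for a.e. t > 0 one has u(t,x) = 0 for a.e. x with |x| ≥ R. Then u vanishes in finite time: there exists T_e ∈ (0,∞) such that u(t,x) = 0 for a.e. x ∈ ℝ^N and a.e. t ≥ T_e. -/

import Mathlib

open MeasureTheory Set

noncomputable section

/-- A non-negative weak solution of `∂ₜ u = Δ(uᵐ) − w(x) u^q` on `(0,∞)×ℝᴺ`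
with initial condition `u₀`, in the sense of Definition 1.1 of the paper:
`u` is a bounded non-negative measurable function, and there is a measurable
vector field `g` (the weak spatial gradient of `uᵐ`) which is locally square
integrable on `(0,T)×ℝᴺ`, satisfies the weak derivative identity against test
functions in `C_c^1((0,T)×ℝᴺ)`, and satisfies the weak formulation of the
equation against test functions in `C_c^1([0,T)×ℝᴺ)`. -/
def IsWeakSolution (N : ℕ) (m q : ℝ) (w : EuclideanSpace ℝ (Fin N) → ℝ)
    (u0 : EuclideanSpace ℝ (Fin N) → ℝ)
    (u : ℝ → EuclideanSpace ℝ (Fin N) → ℝ) : Prop :=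
  Measurable (Function.uncurry u) ∧
  (∀ t x, 0 ≤ u t x) ∧
  (∃ C : ℝ, ∀ t x, u t x ≤ C) ∧
  ∃ g : ℝ → EuclideanSpace ℝ (Fin N) → EuclideanSpace ℝ (Fin N),
    Measurable (Function.uncurry g) ∧
    ∀ T > (0:ℝ),
      (∀ K : Set (EuclideanSpace ℝ (Fin N)), IsCompact K →
        ∫⁻ s in Ioo (0:ℝ) T, ∫⁻ x in K, ENNReal.ofReal (‖g s x‖ ^ 2) < ⊤) ∧
      (∀ ζ : ℝ × EuclideanSpace ℝ (Fin N) → ℝ, ContDiff ℝ 1 ζ →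
        HasCompactSupport ζ → (∀ s x, s ∉ Ioo (0:ℝ) T → ζ (s, x) = 0) →
        ∀ i : Fin N,
          (∫ s in Ioo (0:ℝ) T, ∫ x,
              (u s x) ^ m * fderiv ℝ ζ (s, x) (0, EuclideanSpace.single i 1))
            = - ∫ s in Ioo (0:ℝ) T, ∫ x, g s x i * ζ (s, x)) ∧
      (∀ ζ : ℝ × EuclideanSpace ℝ (Fin N) → ℝ, ContDiff ℝ 1 ζ →
        HasCompactSupport ζ → (∀ s x, T ≤ s → ζ (s, x) = 0) →
        ∫ s in Ioo (0:ℝ) T, ∫ x,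
            ((u0 x - u s x) * fderiv ℝ ζ (s, x) (1, 0)
              + fderiv ℝ ζ (s, x) (0, g s x)
              + w x * (u s x) ^ q * ζ (s, x)) = 0)

/-- `u₀` is a non-negative function in `L^∞(ℝᴺ)`. -/
def IsBddNonneg (N : ℕ) (u0 : EuclideanSpace ℝ (Fin N) → ℝ) : Prop :=
  Measurable u0 ∧ (∀ x, 0 ≤ u0 x) ∧ ∃ C : ℝ, ∀ x, u0 x ≤ C

/-- The solution `u` vanishes in finite time. -/
def VanishesInFiniteTime (N : ℕ) (u : ℝ → EuclideanSpace ℝ (Fin N) → ℝ) : Prop :=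
  ∃ Te : ℝ, 0 < Te ∧ ∀ᵐ t : ℝ, Te ≤ t → ∀ᵐ x : EuclideanSpace ℝ (Fin N), u t x = 0

/-- The support of `u(t)` is contained in `B(0,R)` for a.e. `t > 0`. -/
def SupportLocalized (N : ℕ) (R : ℝ) (u : ℝ → EuclideanSpace ℝ (Fin N) → ℝ) : Prop :=
  ∀ᵐ t : ℝ, 0 < t → ∀ᵐ x : EuclideanSpace ℝ (Fin N), R ≤ ‖x‖ → u t x = 0

/-- real exponent pointwise facts -/
lemma hp_integrable {N : ℕ} {f : EuclideanSpace ℝ (Fin N) → ℝ} (hf : Continuous f)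
    (hc : HasCompactSupport f) : Integrable f := hf.integrable_of_hasCompactSupport hc

lemma euler_ibp {N : ℕ} (h : EuclideanSpace ℝ (Fin N) → ℝ) (hh : ContDiff ℝ 1 h)
    (hc : HasCompactSupport h) :
    ∫ x, ((N:ℝ) * h x + fderiv ℝ h x x) = 0 := by
  have hcont := hh.continuous
  have hdc : Continuous (fderiv ℝ h) := hh.continuous_fderiv (by norm_num)
  have hdcs : HasCompactSupport (fderiv ℝ h) := hc.fderiv (𝕜 := ℝ)
  have hint : Integrable h := hp_integrable hcont hc
  have key : ∀ i : Fin N, ∫ x : EuclideanSpace ℝ (Fin N),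
      x i * fderiv ℝ h x (EuclideanSpace.single i 1) = - ∫ x, h x := by
    intro i
    have hi : ∀ x : EuclideanSpace ℝ (Fin N),
        HasFDerivAt (fun x : EuclideanSpace ℝ (Fin N) => x i)
        (EuclideanSpace.proj i : EuclideanSpace ℝ (Fin N) →L[ℝ] ℝ) x := by
      intro x
      exact (EuclideanSpace.proj i : EuclideanSpace ℝ (Fin N) →L[ℝ] ℝ).hasFDerivAt
    have hfd : ∀ x : EuclideanSpace ℝ (Fin N),
        fderiv ℝ (fun x : EuclideanSpace ℝ (Fin N) => x i) x (EuclideanSpace.single i 1) = 1 := by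
      intro x
      rw [(hi x).fderiv]; simp
    have := integral_mul_fderiv_eq_neg_fderiv_mul_of_integrable (μ := volume)
      (f := fun x : EuclideanSpace ℝ (Fin N) => x i) (g := h) (v := EuclideanSpace.single i 1)
      ?_ ?_ ?_ (fun x _ => (hi x).differentiableAt) (fun x _ => hh.differentiable (by norm_num) x)
    · rw [this]; simp [hfd]
    · simpa [hfd] using hint
    · apply hp_integrable
      · fun_prop
      · have : HasCompactSupport (fun x => fderiv ℝ h x (EuclideanSpace.single i 1)) :=
          hdcs.comp_left (g := fun L : EuclideanSpace ℝ (Fin N) →L[ℝ] ℝ =>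
            L (EuclideanSpace.single i 1)) (by simp)
        exact this.mul_left
    · apply hp_integrable
      · fun_prop
      · exact hc.mul_left
  have hexp : ∀ x : EuclideanSpace ℝ (Fin N),
      fderiv ℝ h x x = ∑ i, x i * fderiv ℝ h x (EuclideanSpace.single i 1) := by
    intro x
    conv_lhs => rw [show x = ∑ i, x i • EuclideanSpace.single i (1:ℝ) by
      ext j; simp [Finset.sum_apply, Pi.single_apply]]
    simp only [map_sum, map_smul, smul_eq_mul]
    congr 1; funext i; congr 3
    ext j; simp [Finset.sum_apply, Pi.single_apply]
  have hintd : ∀ i : Fin N, Integrable (fun x : EuclideanSpace ℝ (Fin N) =>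
      x i * fderiv ℝ h x (EuclideanSpace.single i 1)) := by
    intro i
    apply hp_integrable
    · fun_prop
    · have : HasCompactSupport (fun x => fderiv ℝ h x (EuclideanSpace.single i 1)) :=
          hdcs.comp_left (g := fun L : EuclideanSpace ℝ (Fin N) →L[ℝ] ℝ =>
            L (EuclideanSpace.single i 1)) (by simp)
      exact this.mul_left
  simp_rw [hexp]
  rw [integral_add (hint.const_mul _) (integrable_finsetSum _ (fun i _ => hintd i)),
    integral_finsetSum _ (fun i _ => hintd i)]
  simp [key, integral_const_mul]

lemma hardy_deriv {N : ℕ} (hN : 1 ≤ N) (f : EuclideanSpace ℝ (Fin N) → ℝ) (hf : ContDiff ℝ 1 f)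
    (hc : HasCompactSupport f) (hf0 : ∀ x, 0 ≤ f x) {κ δ : ℝ} (hκ0 : 0 < κ) (hκ1 : κ ≤ 1)
    (hδ : 0 < δ) :
    ∃ Q : EuclideanSpace ℝ (Fin N) → ℝ, (∀ x, Q x = (f x ^ 2 + δ) ^ κ + ‖x‖ ^ 2) ∧
    Continuous Q ∧ (∀ x, 0 < Q x) ∧
    ∫ x, (f x ^ 2 / Q x) * (3 / 4 - 2 * ‖x‖ ^ 2 / Q x) ≤ 4 * ∫ x, ‖fderiv ℝ f x‖ ^ 2 := by
  set Q : EuclideanSpace ℝ (Fin N) → ℝ := fun x => (f x ^ 2 + δ) ^ κ + ‖x‖ ^ 2 with hQ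
  have hpos : ∀ x, 0 < f x ^ 2 + δ := fun x => by positivity
  have hQpos : ∀ x, 0 < Q x := fun x => by
    have := Real.rpow_pos_of_pos (hpos x) κ
    have h2 := sq_nonneg ‖x‖
    simp only [hQ]; linarith
  have hQc : ContDiff ℝ 1 Q := by
    apply ContDiff.add
    · exact ContDiff.rpow_const_of_ne (by fun_prop) (fun x => (hpos x).ne')
    · exact contDiff_norm_sq ℝ
  refine ⟨Q, fun x => rfl, hQc.continuous, hQpos, ?_⟩
  have hQcont := hQc.continuous
  have hfcont := hf.continuous
  have hdc : Continuous (fderiv ℝ f) := hf.continuous_fderiv (by norm_num)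
  set h : EuclideanSpace ℝ (Fin N) → ℝ := fun x => f x ^ 2 / Q x with hh
  have hhc : ContDiff ℝ 1 h := ContDiff.div (by fun_prop) hQc (fun x => (hQpos x).ne')
  have hhcs : HasCompactSupport h := by
    apply hc.mono
    intro x hx hx'
    apply hx
    simp [hh, hx']
  have hE := euler_ibp h hhc hhcs
  have hder : ∀ x, fderiv ℝ h x x =
      (2 * f x * fderiv ℝ f x x * Q x -
        f x ^ 2 * ((2 * f x * fderiv ℝ f x x) * κ * (f x ^ 2 + δ) ^ (κ - 1) + 2 * ‖x‖ ^ 2))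
        / Q x ^ 2 := by
    intro x
    have hfl : HasDerivAt (fun t : ℝ => f (x + t • x)) (fderiv ℝ f x x) 0 := by
      have := (hf.differentiable (by norm_num) x).hasFDerivAt.hasLineDerivAt x
      exact this
    have hhl : HasDerivAt (fun t : ℝ => h (x + t • x)) (fderiv ℝ h x x) 0 := by
      have := (hhc.differentiable (by norm_num) x).hasFDerivAt.hasLineDerivAt x
      exact this
    have hnl : HasDerivAt (fun t : ℝ => ‖x + t • x‖ ^ 2) (2 * ‖x‖ ^ 2) 0 := by
      have h1 : (fun t : ℝ => ‖x + t • x‖ ^ 2) = fun t => (1 + t) ^ 2 * ‖x‖ ^ 2 := by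
        funext t
        rw [show x + t • x = (1 + t) • x by rw [add_smul, one_smul], norm_smul, mul_pow,
          Real.norm_eq_abs, sq_abs]
      rw [h1]
      have : HasDerivAt (fun t : ℝ => (1 + t)) 1 0 := by
        simpa using (hasDerivAt_id (0:ℝ)).const_add 1
      have := (this.pow 2).mul_const (‖x‖ ^ 2)
      simpa using this
    have hsq := (hfl.pow 2)
    have hsqd := hsq.add_const δ
    have hrp := hsqd.rpow_const (p := κ) (Or.inl (by simpa using (hpos x).ne'))
    have hQl := hrp.add hnl
    have hdiv := hsq.div hQl (by simpa using (hQpos x).ne')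
    have huniq := hhl.unique hdiv
    rw [huniq]
    simp [hQ]
  have hpt : ∀ x, h x * (3 / 4 - 2 * ‖x‖ ^ 2 / Q x) - 4 * ‖fderiv ℝ f x‖ ^ 2
      ≤ N * h x + fderiv ℝ h x x := by
    intro x
    rw [hder x]
    set D := fderiv ℝ f x x with hD
    have hDle : |D| ≤ ‖fderiv ℝ f x‖ * ‖x‖ := by
      simpa using (fderiv ℝ f x).le_opNorm x
    set q := Q x with hq
    have hq0 : 0 < q := hQpos x
    have hxq : ‖x‖ ^ 2 ≤ q := by
      have := Real.rpow_pos_of_pos (hpos x) κ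
      simp only [hq, hQ]; linarith
    set P := f x ^ 2 * (f x ^ 2 + δ) ^ (κ - 1) with hP
    have hP0 : 0 ≤ P := by
      have := Real.rpow_pos_of_pos (hpos x) (κ - 1)
      positivity
    have hPq : P ≤ q := by
      have h1 : (f x ^ 2 + δ) ^ κ = (f x ^ 2 + δ) * (f x ^ 2 + δ) ^ (κ - 1) := by
        rw [Real.rpow_sub_one (hpos x).ne']
        field_simp
      have h2 := Real.rpow_pos_of_pos (hpos x) (κ - 1)
      have h3 : P ≤ (f x ^ 2 + δ) ^ κ := by
        rw [h1]; nlinarith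
      have := sq_nonneg ‖x‖
      simp only [hq, hQ]; linarith
    have hN' : (1:ℝ) ≤ N := by exact_mod_cast hN
    have hh0 : 0 ≤ h x := by simp only [hh]; have := hQpos x; positivity
    have hre : (2 * f x * D * q - f x ^ 2 *
        ((2 * f x * D) * κ * (f x ^ 2 + δ) ^ (κ - 1) + 2 * ‖x‖ ^ 2)) / q ^ 2
        = (f x * D / q) * (2 * (1 - κ * P / q)) - h x * (2 * ‖x‖ ^ 2 / q) := by
      simp only [hh, hP, ← hq]
      field_simp
      ring
    rw [hre]
    have hbr0 : 0 ≤ 1 - κ * P / q := by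
      have : κ * P / q ≤ 1 := by
        rw [div_le_one hq0]; nlinarith
      linarith
    have hbr1 : 1 - κ * P / q ≤ 1 := by
      have : 0 ≤ κ * P / q := by positivity
      linarith
    have hcross : |f x * D / q| ≤ (1/8) * h x + 2 * ‖fderiv ℝ f x‖ ^ 2 := by
      rw [abs_div, abs_mul, abs_of_nonneg (hf0 x), abs_of_pos hq0]
      have e1 : f x * |D| / q ≤ f x * (‖fderiv ℝ f x‖ * ‖x‖) / q := by
        have := hf0 x
        gcongr
      have e2 : f x * (‖fderiv ℝ f x‖ * ‖x‖) / q ≤ (1/8) * h x + 2 * ‖fderiv ℝ f x‖ ^ 2 := by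
        simp only [hh, ← hq]
        rw [div_le_iff₀ hq0]
        have : ((1/8) * (f x ^ 2 / q) + 2 * ‖fderiv ℝ f x‖ ^ 2) * q
          = (1/8) * f x ^ 2 + 2 * ‖fderiv ℝ f x‖ ^ 2 * q := by field_simp
        rw [this]
        have a1 : 2 * ‖fderiv ℝ f x‖ ^ 2 * ‖x‖ ^ 2 ≤ 2 * ‖fderiv ℝ f x‖ ^ 2 * q := by gcongr
        nlinarith [sq_nonneg (f x - 4 * (‖fderiv ℝ f x‖ * ‖x‖))]
      linarith
    have hc2 : -(2 * |f x * D / q|) ≤ (f x * D / q) * (2 * (1 - κ * P / q)) := by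
      have := neg_abs_le (f x * D / q)
      have h0 := abs_nonneg (f x * D / q)
      nlinarith
    nlinarith
  have hi1 : Integrable (fun x => h x * (3 / 4 - 2 * ‖x‖ ^ 2 / Q x)) := by
    apply hp_integrable
    · exact hhc.continuous.mul (continuous_const.sub
        (Continuous.div (by fun_prop) hQcont (fun x => (hQpos x).ne')))
    · exact hhcs.mul_right
  have hi2 : Integrable (fun x => ‖fderiv ℝ f x‖ ^ 2) := by
    apply hp_integrable
    · fun_prop
    · exact (hc.fderiv (𝕜 := ℝ)).comp_left (g := fun L => ‖L‖ ^ 2) (by simp)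
  have hi3 : Integrable (fun x => (N:ℝ) * h x + fderiv ℝ h x x) := by
    apply hp_integrable
    · have : Continuous (fderiv ℝ h) := hhc.continuous_fderiv (by norm_num)
      have := hhc.continuous
      fun_prop
    · apply HasCompactSupport.add
      · exact hhcs.mul_left
      · apply (hhcs.fderiv (𝕜 := ℝ)).mono
        intro x hx hx'
        apply hx
        simp [hx']
  have := integral_mono (hi1.sub (hi2.const_mul 4)) hi3 hpt
  rw [hE] at this
  simp only [Pi.sub_apply] at this
  rw [integral_sub hi1 (hi2.const_mul 4), integral_const_mul] at this
  linarith

lemma hardy_ptwise {a X Q κ σ r δ s : ℝ} (ha : 0 ≤ a) (hX : 0 ≤ X) (hκ0 : 0 < κ) (hκ1 : κ ≤ 1)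
    (hσ : 0 < σ) (hr : 0 < r) (hδ : 0 < δ) (hκ : κ * (σ + 2) = 2 - r) (hs : s = 2 - 2 * κ)
    (hs0 : 0 < s)
    (hQ : Q = (a ^ 2 + δ) ^ κ + X ^ 2) :
    a ^ s ≤ 6 * ((a ^ 2 / Q) * (3 / 4 - 2 * X ^ 2 / Q)) +
      (12 * 8 ^ ((σ + 2) / 2) + 1) * (X ^ σ * a ^ r) + δ ^ (s / 2) := by
  have hA : 0 < a ^ 2 + δ := by positivity
  have hAk := Real.rpow_pos_of_pos hA κ
  have hQ0 : 0 < Q := by rw [hQ]; positivity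
  have h8 : (1:ℝ) ≤ 8 ^ ((σ + 2) / 2) := Real.one_le_rpow (by norm_num) (by positivity)
  have hXa : 0 ≤ X ^ σ * a ^ r := by positivity
  have hδs : 0 ≤ δ ^ (s / 2) := by positivity
  have haκ : (a ^ 2) ^ κ = a ^ (2 * κ) := by
    rw [← Real.rpow_natCast, ← Real.rpow_mul ha]; norm_num
  -- first: h / 2 ≤ ...
  have h1 : a ^ 2 / Q / 2 ≤ (a ^ 2 / Q) * (3 / 4 - 2 * X ^ 2 / Q) +
      2 * (8 ^ ((σ + 2) / 2) * (X ^ σ * a ^ r)) := by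
    have hh : 0 ≤ a ^ 2 / Q := by positivity
    by_cases hc : X ^ 2 / Q ≤ 1 / 8
    · have : 2 * X ^ 2 / Q ≤ 1 / 4 := by
        rw [mul_div_assoc]; linarith
      have h9 : 0 ≤ 8 ^ ((σ + 2) / 2) * (X ^ σ * a ^ r) := by positivity
      nlinarith
    · push Not at hc
      have hX2 : Q < 8 * X ^ 2 := by
        rw [lt_div_iff₀ hQ0] at hc; linarith
      have hXpos : 0 < X := by
        rcases hX.lt_or_eq with h | h
        · exact h
        · exfalso; rw [← h] at hX2; norm_num at hX2; linarith
      have hle : 2 * X ^ 2 / Q ≤ 2 := by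
        rw [div_le_iff₀ hQ0, hQ]; nlinarith
      -- a^2 / Q ≤ 8^.. X^σ a^r
      have hb : a ^ 2 / Q ≤ 8 ^ ((σ + 2) / 2) * (X ^ σ * a ^ r) := by
        have e1 : a ^ (2 * κ) ≤ 8 * X ^ 2 := by
          rw [← haκ]
          calc (a ^ 2) ^ κ ≤ (a ^ 2 + δ) ^ κ :=
                Real.rpow_le_rpow (by positivity) (by linarith) hκ0.le
            _ ≤ Q := by rw [hQ]; nlinarith
            _ ≤ _ := hX2.le
        have e2 : a ^ (2 - r) ≤ (8 * X ^ 2) ^ ((σ + 2) / 2) := by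
          have : a ^ (2 - r) = (a ^ (2 * κ)) ^ ((σ + 2) / 2) := by
            rw [← Real.rpow_mul ha]; congr 1; rw [← hκ]; ring
          rw [this]
          exact Real.rpow_le_rpow (by positivity) e1 (by positivity)
        have e3 : (8 * X ^ 2) ^ ((σ + 2) / 2) = 8 ^ ((σ + 2) / 2) * (X ^ σ * X ^ 2) := by
          rw [Real.mul_rpow (by norm_num) (by positivity)]
          congr 1
          rw [← Real.rpow_natCast X 2, ← Real.rpow_mul hX, ← Real.rpow_add hXpos]
          congr 1; push_cast; ring
        have e4 : a ^ 2 = a ^ (2 - r) * a ^ r := by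
          rcases ha.lt_or_eq with h | h
          · rw [← Real.rpow_add h, ← Real.rpow_natCast]; congr 1; push_cast; ring
          · rw [← h, Real.zero_rpow hr.ne']; norm_num
        have har : 0 ≤ a ^ r := by positivity
        calc a ^ 2 / Q ≤ a ^ 2 / X ^ 2 := by
              apply div_le_div_of_nonneg_left (by positivity) (by positivity)
              rw [hQ]; linarith
          _ ≤ _ := by
              rw [div_le_iff₀ (by positivity), e4]
              calc a ^ (2 - r) * a ^ r ≤ (8 * X ^ 2) ^ ((σ + 2) / 2) * a ^ r := by gcongr
                _ = _ := by rw [e3]; ring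
      nlinarith
  -- second
  have h2 : a ^ s ≤ 3 * (a ^ 2 / Q) + X ^ σ * a ^ r + δ ^ (s / 2) := by
    have hh : 0 ≤ a ^ 2 / Q := by positivity
    by_cases hc : a ^ 2 < δ
    · have : a ^ s ≤ δ ^ (s / 2) := by
        have : a ^ s = (a ^ 2) ^ (s / 2) := by
          rw [← Real.rpow_natCast, ← Real.rpow_mul ha]; congr 1; push_cast; ring
        rw [this]
        exact Real.rpow_le_rpow (by positivity) hc.le (by positivity)
      linarith
    · push Not at hc
      have hapos : 0 < a := by
        rcases ha.lt_or_eq with h | h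
        · exact h
        · exfalso; rw [← h] at hc; norm_num at hc; linarith
      have h2k : (a ^ 2 + δ) ^ κ ≤ 2 * a ^ (2 * κ) := by
        calc (a ^ 2 + δ) ^ κ ≤ (2 * a ^ 2) ^ κ :=
              Real.rpow_le_rpow hA.le (by linarith) hκ0.le
          _ = 2 ^ κ * a ^ (2 * κ) := by
              rw [Real.mul_rpow (by norm_num) (by positivity), haκ]
          _ ≤ 2 * a ^ (2 * κ) := by
              have : (2:ℝ) ^ κ ≤ 2 ^ (1:ℝ) := Real.rpow_le_rpow_of_exponent_le (by norm_num) hκ1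
              rw [Real.rpow_one] at this
              gcongr
      have hak := Real.rpow_pos_of_pos hapos (2 * κ)
      by_cases hc2 : X ^ 2 ≤ a ^ (2 * κ)
      · have hQle : Q ≤ 3 * a ^ (2 * κ) := by rw [hQ]; linarith
        have : a ^ s ≤ 3 * (a ^ 2 / Q) := by
          rw [← mul_div_assoc, le_div_iff₀ hQ0]
          calc a ^ s * Q ≤ a ^ s * (3 * a ^ (2 * κ)) := by
                have := Real.rpow_pos_of_pos hapos s
                gcongr
            _ = 3 * (a ^ s * a ^ (2 * κ)) := by ring
            _ = 3 * a ^ 2 := by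
                rw [← Real.rpow_add hapos, show s + 2 * κ = ((2:ℕ):ℝ) by rw [hs]; push_cast; ring,
                  Real.rpow_natCast]
        linarith
      · push Not at hc2
        have hXk : a ^ κ ≤ X := by
          have : (a ^ κ) ^ 2 ≤ X ^ 2 := by
            rw [← Real.rpow_natCast, ← Real.rpow_mul ha]
            rw [show κ * ((2:ℕ):ℝ) = 2 * κ by push_cast; ring]; exact hc2.le
          exact le_of_sq_le_sq this hX
        have : a ^ s ≤ X ^ σ * a ^ r := by
          have e : a ^ s = (a ^ κ) ^ σ * a ^ r := by
            rw [← Real.rpow_mul ha, ← Real.rpow_add hapos]; congr 1; rw [hs]; linarith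
          rw [e]
          have := Real.rpow_le_rpow (by positivity) hXk hσ.le
          gcongr
        linarith
  nlinarith

lemma hardy_s {N : ℕ} (hN : 1 ≤ N) {κ σ r s R : ℝ} (hκ0 : 0 < κ) (hκ1 : κ ≤ 1)
    (hσ : 0 < σ) (hr : 0 < r) (hκ : κ * (σ + 2) = 2 - r) (hs : s = 2 - 2 * κ) (hs0 : 0 < s)
    (f : EuclideanSpace ℝ (Fin N) → ℝ) (hf : ContDiff ℝ 1 f)
    (hR : ∀ x, R ≤ ‖x‖ → f x = 0) (hf0 : ∀ x, 0 ≤ f x) :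
    ∫ x, f x ^ s ≤ (24 + 12 * 8 ^ ((σ + 2) / 2) + 1) *
      ((∫ x, ‖fderiv ℝ f x‖ ^ 2) + ∫ x, ‖x‖ ^ σ * f x ^ r) := by
  have hc : HasCompactSupport f := by
    apply HasCompactSupport.intro (isCompact_closedBall (0 : EuclideanSpace ℝ (Fin N)) R)
    intro x hx
    apply hR
    simp at hx; exact hx.le
  have hfc := hf.continuous
  have hzs : ∀ {a : ℝ}, 0 < a → HasCompactSupport (fun x => f x ^ a) := fun ha =>
    hc.comp_left (g := fun t => t ^ _) (Real.zero_rpow ha.ne')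
  have hi1 : Integrable (fun x => f x ^ s) :=
    hp_integrable (hfc.rpow_const (fun x => Or.inr hs0.le)) (hzs hs0)
  have hi2 : Integrable (fun x => ‖x‖ ^ σ * f x ^ r) :=
    hp_integrable ((continuous_norm.rpow_const (fun x => Or.inr hσ.le)).mul
      (hfc.rpow_const (fun x => Or.inr hr.le))) (hzs hr).mul_left
  set B := Metric.closedBall (0 : EuclideanSpace ℝ (Fin N)) R
  set V := volume.real B with hV
  have hH0 : 0 ≤ ∫ x, ‖fderiv ℝ f x‖ ^ 2 := integral_nonneg (fun x => by positivity)
  have hD0 : 0 ≤ ∫ x, ‖x‖ ^ σ * f x ^ r := integral_nonneg (fun x => by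
    have := hf0 x; positivity)
  have main : ∀ δ : ℝ, 0 < δ → ∫ x, f x ^ s ≤ (24 + 12 * 8 ^ ((σ + 2) / 2) + 1) *
      ((∫ x, ‖fderiv ℝ f x‖ ^ 2) + ∫ x, ‖x‖ ^ σ * f x ^ r) + V * δ ^ (s / 2) := by
    intro δ hδ
    obtain ⟨Q, hQ, hQc, hQ0, hle⟩ := hardy_deriv hN f hf hc hf0 hκ0 hκ1 hδ
    have hi3 : Integrable (fun x => (f x ^ 2 / Q x) * (3 / 4 - 2 * ‖x‖ ^ 2 / Q x)) := by
      apply hp_integrable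
      · exact (Continuous.div (by fun_prop) hQc (fun x => (hQ0 x).ne')).mul (continuous_const.sub
          (Continuous.div (by fun_prop) hQc (fun x => (hQ0 x).ne')))
      · apply hc.mono
        intro x hx hx'
        apply hx
        simp [hx']
    have hi4 : Integrable (B.indicator (fun _ : EuclideanSpace ℝ (Fin N) => δ ^ (s / 2))) := by
      rw [integrable_indicator_iff Metric.isClosed_closedBall.measurableSet]
      exact integrableOn_const (by exact (isCompact_closedBall _ _).measure_lt_top.ne)
    have hmono : ∫ x, f x ^ s ≤ ∫ x, (6 * ((f x ^ 2 / Q x) * (3 / 4 - 2 * ‖x‖ ^ 2 / Q x)) +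
        (12 * 8 ^ ((σ + 2) / 2) + 1) * (‖x‖ ^ σ * f x ^ r)
        + B.indicator (fun _ => δ ^ (s / 2)) x) := by
      apply integral_mono hi1
      · exact ((hi3.const_mul 6).add (hi2.const_mul _)).add hi4
      · intro x
        by_cases hx : x ∈ B
        · simp only [indicator_of_mem hx]
          exact hardy_ptwise (hf0 x) (norm_nonneg x) hκ0 hκ1 hσ hr hδ hκ hs hs0 (hQ x)
        · have : f x = 0 := hR x (by simp [B] at hx; exact hx.le)
          simp [this, hx, Real.zero_rpow hs0.ne', Real.zero_rpow hr.ne']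
    rw [integral_add (by exact (hi3.const_mul 6).add (hi2.const_mul _)) hi4,
      integral_add (hi3.const_mul 6) (hi2.const_mul _), integral_const_mul, integral_const_mul,
      integral_indicator Metric.isClosed_closedBall.measurableSet, setIntegral_const,
      smul_eq_mul] at hmono
    have h8 : (0:ℝ) ≤ 8 ^ ((σ + 2) / 2) := by positivity
    rw [← hV] at hmono
    nlinarith [mul_nonneg h8 hH0]
  have hlim : Filter.Tendsto (fun δ : ℝ => (24 + 12 * 8 ^ ((σ + 2) / 2) + 1) *
      ((∫ x, ‖fderiv ℝ f x‖ ^ 2) + ∫ x, ‖x‖ ^ σ * f x ^ r) + V * δ ^ (s / 2))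
      (nhdsWithin 0 (Ioi 0)) (nhds ((24 + 12 * 8 ^ ((σ + 2) / 2) + 1) *
      ((∫ x, ‖fderiv ℝ f x‖ ^ 2) + ∫ x, ‖x‖ ^ σ * f x ^ r) + V * 0 ^ (s / 2))) := by
    apply Filter.Tendsto.mono_left _ nhdsWithin_le_nhds
    apply Continuous.tendsto
    exact continuous_const.add (continuous_const.mul
      (continuous_id.rpow_const (fun x => Or.inr (by positivity))))
  have := ge_of_tendsto hlim (by
    filter_upwards [self_mem_nhdsWithin] with δ hδ using main δ hδ)
  rwa [Real.zero_rpow (by positivity), mul_zero, add_zero] at this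

lemma sq_integral_le {k : ℝ → ℝ} (hk : Continuous k) :
    (∫ τ in (0:ℝ)..1, k τ) ^ 2 ≤ ∫ τ in (0:ℝ)..1, k τ ^ 2 := by
  set c := ∫ τ in (0:ℝ)..1, k τ with hc
  have h0 : 0 ≤ ∫ τ in (0:ℝ)..1, (k τ - c) ^ 2 :=
    intervalIntegral.integral_nonneg (by norm_num) (fun τ _ => sq_nonneg _)
  have : ∫ τ in (0:ℝ)..1, (k τ - c) ^ 2 = (∫ τ in (0:ℝ)..1, k τ ^ 2) - c ^ 2 := by
    have e : ∀ τ, (k τ - c) ^ 2 = k τ ^ 2 - (2 * c) * k τ + c ^ 2 := fun τ => by ring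
    simp_rw [e]
    rw [intervalIntegral.integral_add, intervalIntegral.integral_sub,
      intervalIntegral.integral_const_mul, ← hc]
    · simp; ring
    all_goals exact Continuous.intervalIntegrable (by fun_prop) _ _
  linarith

lemma translate_bound {N : ℕ} (f : EuclideanSpace ℝ (Fin N) → ℝ) (hf : ContDiff ℝ 1 f)
    (hc : HasCompactSupport f) (z : EuclideanSpace ℝ (Fin N)) :
    ∫ x, (f (x + z) - f x) ^ 2 ≤ ‖z‖ ^ 2 * ∫ x, ‖fderiv ℝ f x‖ ^ 2 := by
  have hfc := hf.continuous
  have hdc : Continuous (fderiv ℝ f) := hf.continuous_fderiv (by norm_num)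
  set K : EuclideanSpace ℝ (Fin N) → ℝ := fun x => ‖fderiv ℝ f x‖ ^ 2 with hK
  have hKc : Continuous K := by fun_prop
  have hKi : Integrable K := by
    apply hp_integrable hKc
    exact (hc.fderiv (𝕜 := ℝ)).comp_left (g := fun L => ‖L‖ ^ 2) (by simp)
  set ν : Measure ℝ := volume.restrict (Ioc 0 1) with hν
  have hprod : Integrable (fun p : EuclideanSpace ℝ (Fin N) × ℝ => K (p.1 + p.2 • z))
      (volume.prod ν) := by
    rw [integrable_prod_iff']
    · constructor
      · exact Filter.Eventually.of_forall (fun τ => hKi.comp_add_right (τ • z))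
      · have : ∀ τ : ℝ, ∫ x, ‖K (x + τ • z)‖ = ∫ x, K x := by
          intro τ
          rw [integral_add_right_eq_self (fun x => ‖K x‖)]
          congr 1; funext x; simp [hK]
        simp only [this]
        exact integrable_const _
    · exact (Continuous.aestronglyMeasurable (by fun_prop))
  have hpt : ∀ x, (f (x + z) - f x) ^ 2 ≤ ‖z‖ ^ 2 * ∫ τ, K (x + τ • z) ∂ν := by
    intro x
    have h1 : ∫ τ in (0:ℝ)..1, fderiv ℝ f (x + τ • z) z = f (x + z) - f x := by
      have := intervalIntegral.integral_eq_sub_of_hasDerivAt (a := 0) (b := 1)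
        (f := fun τ : ℝ => f (x + τ • z)) (f' := fun τ => fderiv ℝ f (x + τ • z) z)
        ?_ ?_
      · simpa using this
      · intro τ _
        have hfd := (hf.differentiable (by norm_num) (x + τ • z)).hasFDerivAt
        have hl : HasDerivAt (fun τ : ℝ => x + τ • z) z τ := by
          simpa using ((hasDerivAt_id τ).smul_const z).const_add x
        exact hfd.comp_hasDerivAt τ hl
      · exact Continuous.intervalIntegrable (by fun_prop) _ _
    rw [← h1]
    refine (sq_integral_le (by fun_prop)).trans ?_
    rw [intervalIntegral.integral_of_le (by norm_num), ← integral_const_mul]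
    apply integral_mono
    · exact (Continuous.integrableOn_Ioc (by fun_prop))
    · exact (Continuous.integrableOn_Ioc (by fun_prop))
    · intro τ
      have := (fderiv ℝ f (x + τ • z)).le_opNorm z
      simp only [hK]
      rw [← mul_pow, mul_comm, ← sq_abs]
      gcongr
      exact this
  have hint := hprod.integral_prod_left
  calc ∫ x, (f (x + z) - f x) ^ 2 ≤ ∫ x, ‖z‖ ^ 2 * ∫ τ, K (x + τ • z) ∂ν := by
        apply integral_mono
        · apply hp_integrable (by fun_prop)
          have h1 : HasCompactSupport (fun x => f (x + z)) := hc.comp_homeomorph (Homeomorph.addRight z)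
          have h2 : HasCompactSupport (fun x => f (x + z) - f x) := h1.sub hc
          exact h2.comp_left (g := fun t => t ^ 2) (by norm_num)
        · exact hint.const_mul _
        · exact hpt
    _ = ‖z‖ ^ 2 * ∫ τ, ∫ x, K (x + τ • z) ∂volume ∂ν := by
        rw [integral_const_mul, integral_integral_swap hprod]
    _ = _ := by
        congr 1
        have : ∀ τ : ℝ, ∫ x, K (x + τ • z) = ∫ x, K x := fun τ =>
          integral_add_right_eq_self K (τ • z)
        simp [this, hν]

lemma nash {N : ℕ} (f : EuclideanSpace ℝ (Fin N) → ℝ) (hf : ContDiff ℝ 1 f)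
    (hc : HasCompactSupport f) (hf0 : ∀ x, 0 ≤ f x) {ρ : ℝ} (hρ : 0 < ρ) :
    ∫ x, f x ^ 2 ≤ ρ ^ 2 * (∫ x, ‖fderiv ℝ f x‖ ^ 2) +
      2 * (volume.real (Metric.ball (0 : EuclideanSpace ℝ (Fin N)) ρ))⁻¹ * (∫ x, f x) ^ 2 := by
  have hfc := hf.continuous
  set H := ∫ x, ‖fderiv ℝ f x‖ ^ 2 with hH
  have hH0 : 0 ≤ H := integral_nonneg (fun x => by positivity)
  set B := Metric.ball (0 : EuclideanSpace ℝ (Fin N)) ρ with hB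
  have hBm : MeasurableSet B := Metric.isOpen_ball.measurableSet
  have hBfin : volume B ≠ ⊤ := Metric.isBounded_ball.measure_lt_top.ne
  have hV : 0 < volume.real B :=
    ENNReal.toReal_pos (Metric.measure_ball_pos _ _ hρ).ne' hBfin
  have hfi : Integrable f := hp_integrable hfc hc
  have hf2 : Integrable (fun x => f x ^ 2) :=
    hp_integrable (by fun_prop) (hc.comp_left (g := fun t => t ^ 2) (by norm_num))
  have hprod : Integrable (fun p : EuclideanSpace ℝ (Fin N) × EuclideanSpace ℝ (Fin N) =>
      f p.1 * f (p.1 + p.2)) (volume.prod volume) := by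
    have h1 := hfi.mul_prod hfi
    have h2 := measurePreserving_prod_add (volume : Measure (EuclideanSpace ℝ (Fin N)))
      (volume : Measure (EuclideanSpace ℝ (Fin N)))
    exact h2.integrable_comp_of_integrable h1
  have hΦ := hprod.integral_prod_right
  simp only at hΦ
  have hz : ∀ z, ∫ x, f x ^ 2 ≤ ‖z‖ ^ 2 * H + 2 * ∫ x, f x * f (x + z) := by
    intro z
    have ht := translate_bound f hf hc z
    have h1 : HasCompactSupport (fun x => f (x + z)) := hc.comp_homeomorph (Homeomorph.addRight z)
    have hi1 : Integrable (fun x => f x * f (x + z)) := hp_integrable (by fun_prop) hc.mul_right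
    have hi2 : Integrable (fun x => f (x + z) ^ 2) := hf2.comp_add_right z
    have he : ∫ x, (f (x + z) - f x) ^ 2 =
        (∫ x, f (x + z) ^ 2) - 2 * (∫ x, f x * f (x + z)) + ∫ x, f x ^ 2 := by
      rw [← integral_const_mul, ← integral_sub hi2 (hi1.const_mul 2), ← integral_add
        (by exact hi2.sub (hi1.const_mul 2)) hf2]
      congr 1; funext x; ring
    rw [integral_add_right_eq_self (fun x => f x ^ 2)] at he
    have h3 : 0 ≤ ∫ x, f x ^ 2 := integral_nonneg (fun x => by positivity)
    have h4 : 0 ≤ ‖z‖ ^ 2 * H := by positivity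
    linarith
  have htot : ∫ z, ∫ x, f x * f (x + z) = (∫ x, f x) ^ 2 := by
    rw [integral_integral_swap]
    · have : ∀ x, ∫ z, f x * f (x + z) = f x * ∫ z, f z := by
        intro x
        rw [integral_const_mul, integral_add_left_eq_self f x]
      simp_rw [this]
      rw [integral_mul_const, sq]
    · exact hprod.swap
  have hint : volume.real B * ∫ x, f x ^ 2 ≤ volume.real B * (ρ ^ 2 * H) + 2 * (∫ x, f x) ^ 2 := by
    calc volume.real B * ∫ x, f x ^ 2 = ∫ z in B, ∫ x, f x ^ 2 := by
          rw [setIntegral_const, smul_eq_mul]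
      _ ≤ ∫ z in B, (ρ ^ 2 * H + 2 * ∫ x, f x * f (x + z)) := by
          apply setIntegral_mono_on
          · exact integrableOn_const hBfin
          · exact (integrableOn_const hBfin).add (hΦ.const_mul 2).integrableOn
          · exact hBm
          · intro z hzB
            have h5 : ‖z‖ ≤ ρ := by simp [hB] at hzB; exact hzB.le
            have h6 : ‖z‖ ^ 2 * H ≤ ρ ^ 2 * H := by gcongr
            have := hz z
            linarith
      _ = volume.real B * (ρ ^ 2 * H) + 2 * ∫ z in B, ∫ x, f x * f (x + z) := by
          have hcst : Integrable (fun _ : EuclideanSpace ℝ (Fin N) => ρ ^ 2 * H)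
              (volume.restrict B) := integrableOn_const hBfin
          have hsec : Integrable (fun z => 2 * ∫ x, f x * f (x + z))
              (volume.restrict B) := (hΦ.const_mul 2).integrableOn
          rw [integral_add hcst hsec,
            setIntegral_const, smul_eq_mul, integral_const_mul]
      _ ≤ _ := by
          have : ∫ z in B, ∫ x, f x * f (x + z) ≤ ∫ z, ∫ x, f x * f (x + z) := by
            apply setIntegral_le_integral hΦ
            exact Filter.Eventually.of_forall (fun z => integral_nonneg
              (fun x => mul_nonneg (hf0 _) (hf0 _)))
          rw [htot] at this
          linarith
  have h7 : ∫ x, f x ^ 2 ≤ (volume.real B * (ρ ^ 2 * H) + 2 * (∫ x, f x) ^ 2) / volume.real B := by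
    rw [le_div_iff₀ hV]; linarith
  calc _ ≤ _ := h7
    _ = _ := by field_simp

lemma young_split {a l b c p : ℝ} (ha : 0 ≤ a) (hl : 0 < l) (hb : 0 < b) (hbp : b ≤ p) (hpc : p ≤ c) :
    a ^ p ≤ l ^ (p - b) * a ^ b + l ^ (p - c) * a ^ c := by
  rcases ha.lt_or_eq with h | h
  · by_cases hal : a ≤ l
    · have h1 : a ^ p = a ^ (p - b) * a ^ b := by rw [← Real.rpow_add h]; congr 1; ring
      have h2 : a ^ (p - b) ≤ l ^ (p - b) := Real.rpow_le_rpow ha hal (by linarith)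
      have h3 : 0 ≤ l ^ (p - c) * a ^ c := by positivity
      have h4 : 0 ≤ a ^ b := by positivity
      rw [h1]; nlinarith
    · push Not at hal
      have h1 : a ^ p = a ^ (p - c) * a ^ c := by rw [← Real.rpow_add h]; congr 1; ring
      have h2 : a ^ (p - c) ≤ l ^ (p - c) :=
        Real.rpow_le_rpow_of_nonpos hl hal.le (by linarith)
      have h3 : 0 ≤ l ^ (p - b) * a ^ b := by positivity
      have h4 : 0 ≤ a ^ c := by positivity
      rw [h1]; nlinarith
  · rw [← h, Real.zero_rpow (by linarith), Real.zero_rpow hb.ne', Real.zero_rpow (by linarith)]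
    simp

lemma func_ineq {N : ℕ} (hN : 1 ≤ N) {σ r p M R : ℝ} (hσ : 0 < σ) (hr : 0 < r) (hr2 : r < 2)
    (hp1 : 1 < p) (hp2 : p < 2) (hsp : (2 * σ + 2 * r) / (σ + 2) < p) (hM : 0 < M) :
    ∃ C η : ℝ, 0 < C ∧ 0 < η ∧ ∀ f : EuclideanSpace ℝ (Fin N) → ℝ, ContDiff ℝ 1 f →
      (∀ x, 0 ≤ f x) → (∀ x, f x ≤ M) → (∀ x, R ≤ ‖x‖ → f x = 0) →
      ∀ e : ℝ, 0 < e → e ≤ 1 →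
      (∫ x, ‖fderiv ℝ f x‖ ^ 2) + (∫ x, ‖x‖ ^ σ * f x ^ r) ≤ e →
      ∫ x, f x ^ p ≤ C * e ^ (1 + η) := by
  set κ := (2 - r) / (σ + 2) with hκd
  have hκ0 : 0 < κ := div_pos (by linarith) (by linarith)
  have hκ1 : κ ≤ 1 := by rw [hκd, div_le_one (by linarith)]; linarith
  have hκ : κ * (σ + 2) = 2 - r := by rw [hκd]; field_simp
  set s := 2 - 2 * κ with hs
  have hs' : s = (2 * σ + 2 * r) / (σ + 2) := by rw [hs, hκd]; field_simp; ring
  have hs0 : 0 < s := by rw [hs']; positivity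
  have hsp' : s < p := by rw [hs']; exact hsp
  set s1 := max s 1 with hs1
  have hs1s : s ≤ s1 := le_max_left _ _
  have hs11 : 1 ≤ s1 := le_max_right _ _
  have hs10 : 0 < s1 := by linarith
  have hs1p : s1 < p := max_lt hsp' hp1
  set C0 : ℝ := 24 + 12 * 8 ^ ((σ + 2) / 2) + 1 with hC0
  have hC00 : 0 < C0 := by positivity
  set C1 := M ^ (s1 - s) * C0 with hC1
  have hC10 : 0 < C1 := by positivity
  set B := Metric.closedBall (0 : EuclideanSpace ℝ (Fin N)) R with hB
  set V := volume.real B with hV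
  have hV0 : 0 ≤ V := measureReal_nonneg
  have hBfin : volume B ≠ ⊤ := (isCompact_closedBall _ _).measure_lt_top.ne
  have hBm : MeasurableSet B := Metric.isClosed_closedBall.measurableSet
  set C2 := V + C1 with hC2
  have hC20 : 0 < C2 := by positivity
  set v1 := volume.real (Metric.ball (0 : EuclideanSpace ℝ (Fin N)) 1) with hv1
  have hv10 : 0 < v1 :=
    ENNReal.toReal_pos (Metric.measure_ball_pos _ _ one_pos).ne' Metric.isBounded_ball.measure_lt_top.ne
  set C3 := 1 + 2 * v1⁻¹ * C2 ^ 2 with hC3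
  have hC30 : 0 < C3 := by positivity
  set β := (2 / s1 - 1) / (N + 2) with hβ
  have hβ0 : 0 < β := by
    apply div_pos
    · have : 1 < 2 / s1 := by rw [lt_div_iff₀ hs10]; linarith
      linarith
    · positivity
  have hβ' : 2 / s1 = 1 + 2 * β + N * β := by
    have : β * (N + 2) = 2 / s1 - 1 := by rw [hβ]; field_simp
    linarith
  refine ⟨C1 + C3, (p - s1) * β, by positivity, mul_pos (by linarith) hβ0, ?_⟩
  intro f hf hf0 hfM hR e he0 he1 hE
  have hfc := hf.continuous
  have hc : HasCompactSupport f := by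
    apply HasCompactSupport.intro (isCompact_closedBall (0 : EuclideanSpace ℝ (Fin N)) R)
    intro x hx
    apply hR
    simp at hx; exact hx.le
  have hzs : ∀ {a : ℝ}, 0 < a → Integrable (fun x => f x ^ a) := fun {a} ha =>
    hp_integrable (hfc.rpow_const (fun x => Or.inr ha.le))
      (hc.comp_left (g := fun t => t ^ a) (Real.zero_rpow ha.ne'))
  have hfi : Integrable f := hp_integrable hfc hc
  -- I1
  have I0 := hardy_s hN hκ0 hκ1 hσ hr hκ hs hs0 f hf hR hf0
  have I1 : ∫ x, f x ^ s1 ≤ C1 * e := by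
    calc ∫ x, f x ^ s1 ≤ ∫ x, M ^ (s1 - s) * f x ^ s := by
          apply integral_mono (hzs hs10) ((hzs hs0).const_mul _)
          intro x
          simp only
          rcases (hf0 x).lt_or_eq with h | h
          · have h1 : f x ^ s1 = f x ^ (s1 - s) * f x ^ s := by
              rw [← Real.rpow_add h]; congr 1; ring
            have h2 : f x ^ (s1 - s) ≤ M ^ (s1 - s) := Real.rpow_le_rpow (hf0 x) (hfM x) (by linarith)
            rw [h1]; gcongr
          · rw [← h, Real.zero_rpow hs10.ne', Real.zero_rpow hs0.ne']; simp
      _ = M ^ (s1 - s) * ∫ x, f x ^ s := integral_const_mul _ _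
      _ ≤ M ^ (s1 - s) * (C0 * e) := by
          gcongr
          refine I0.trans ?_
          gcongr
      _ = C1 * e := by rw [hC1]; ring
  -- I2
  have I2 : ∫ x, f x ≤ C2 * e ^ (1 / s1) := by
    set θ := e ^ (1 / s1) with hθ
    have hθ0 : 0 < θ := by positivity
    have hi4 : Integrable (B.indicator (fun _ : EuclideanSpace ℝ (Fin N) => θ)) := by
      rw [integrable_indicator_iff hBm]
      exact integrableOn_const hBfin
    calc ∫ x, f x ≤ ∫ x, (B.indicator (fun _ => θ) x + θ ^ (1 - s1) * f x ^ s1) := by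
          apply integral_mono hfi (hi4.add ((hzs hs10).const_mul _))
          intro x
          change f x ≤ B.indicator (fun _ => θ) x + θ ^ (1 - s1) * f x ^ s1
          by_cases hx : x ∈ B
          · rw [indicator_of_mem hx]
            by_cases hle : f x ≤ θ
            · have : 0 ≤ θ ^ (1 - s1) * f x ^ s1 := by have := hf0 x; positivity
              linarith
            · push Not at hle
              have hfx : 0 < f x := hθ0.trans hle
              have h1 : f x = f x ^ (1 - s1) * f x ^ s1 := by
                rw [← Real.rpow_add hfx]; simp
              have h2 : f x ^ (1 - s1) ≤ θ ^ (1 - s1) :=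
                Real.rpow_le_rpow_of_nonpos hθ0 hle.le (by linarith)
              have h3 : f x ^ (1 - s1) * f x ^ s1 ≤ θ ^ (1 - s1) * f x ^ s1 := by gcongr
              linarith
          · have : f x = 0 := hR x (by simp [B] at hx; exact hx.le)
            rw [this, Real.zero_rpow hs10.ne', indicator_of_notMem hx]; simp
      _ = V * θ + θ ^ (1 - s1) * ∫ x, f x ^ s1 := by
          rw [integral_add hi4 ((hzs hs10).const_mul _), integral_const_mul,
            integral_indicator hBm, setIntegral_const, smul_eq_mul]
      _ ≤ V * θ + θ ^ (1 - s1) * (C1 * e) := by gcongr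
      _ = C2 * θ := by
          have : θ ^ (1 - s1) * e = θ := by
            rw [hθ, ← Real.rpow_mul he0.le]
            nth_rewrite 2 [← Real.rpow_one e]
            rw [← Real.rpow_add he0]
            congr 1; field_simp; ring
          rw [hC2]
          linear_combination C1 * this
  have hf00 : 0 ≤ ∫ x, f x := integral_nonneg hf0
  -- I3
  have hH0 : 0 ≤ ∫ x, ‖fderiv ℝ f x‖ ^ 2 := integral_nonneg (fun x => by positivity)
  have hD0 : 0 ≤ ∫ x, ‖x‖ ^ σ * f x ^ r := integral_nonneg (fun x => by
    have := hf0 x; positivity)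
  have I3 : ∫ x, f x ^ 2 ≤ C3 * e ^ (1 + 2 * β) := by
    have hρ : 0 < e ^ β := by positivity
    have hn := nash f hf hc hf0 hρ
    have hvol : volume.real (Metric.ball (0 : EuclideanSpace ℝ (Fin N)) (e ^ β)) = (e ^ β) ^ N * v1 := by
      have := Measure.addHaar_ball_of_pos (volume : Measure (EuclideanSpace ℝ (Fin N))) 0 hρ
      rw [Measure.real, this, ENNReal.toReal_mul, ENNReal.toReal_ofReal (by positivity)]
      simp [hv1, Measure.real]
    rw [hvol] at hn
    have e1 : (e ^ β) ^ 2 * e = e ^ (1 + 2 * β) := by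
      rw [← Real.rpow_natCast, ← Real.rpow_mul he0.le]
      nth_rewrite 2 [← Real.rpow_one e]
      rw [← Real.rpow_add he0]; congr 1; push_cast; ring
    have e2 : ((e ^ β) ^ N)⁻¹ * (e ^ (1 / s1)) ^ 2 = e ^ (1 + 2 * β) := by
      rw [← Real.rpow_natCast, ← Real.rpow_natCast, ← Real.rpow_mul he0.le, ← Real.rpow_mul he0.le,
        ← Real.rpow_neg he0.le, ← Real.rpow_add he0]
      congr 1; push_cast
      rw [show 1 / s1 * 2 = 2 / s1 by ring, hβ']; ring
    calc ∫ x, f x ^ 2 ≤ _ := hn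
      _ ≤ (e ^ β) ^ 2 * e + 2 * ((e ^ β) ^ N * v1)⁻¹ * (C2 * e ^ (1 / s1)) ^ 2 := by
          gcongr
          linarith
      _ = (e ^ β) ^ 2 * e + 2 * v1⁻¹ * C2 ^ 2 * (((e ^ β) ^ N)⁻¹ * (e ^ (1 / s1)) ^ 2) := by
          rw [mul_inv]; ring
      _ = C3 * e ^ (1 + 2 * β) := by rw [e1, e2, hC3]; ring
  -- I4
  have hf2 : Integrable (fun x => f x ^ 2) :=
    hp_integrable (by fun_prop) (hc.comp_left (g := fun t => t ^ 2) (by norm_num))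
  set l := e ^ β with hl
  have hl0 : 0 < l := by positivity
  calc ∫ x, f x ^ p ≤ ∫ x, (l ^ (p - s1) * f x ^ s1 + l ^ (p - 2) * f x ^ 2) := by
        apply integral_mono (hzs (by linarith)) (((hzs hs10).const_mul _).add (hf2.const_mul _))
        intro x
        have := young_split (hf0 x) hl0 hs10 hs1p.le hp2.le
        rw [Real.rpow_two] at this
        exact this
    _ = l ^ (p - s1) * (∫ x, f x ^ s1) + l ^ (p - 2) * ∫ x, f x ^ 2 := by
        rw [integral_add ((hzs hs10).const_mul _) (hf2.const_mul _), integral_const_mul,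
          integral_const_mul]
    _ ≤ l ^ (p - s1) * (C1 * e) + l ^ (p - 2) * (C3 * e ^ (1 + 2 * β)) := by gcongr
    _ = C1 * e ^ (1 + (p - s1) * β) + C3 * e ^ (1 + p * β) := by
        have e1 : l ^ (p - s1) * e = e ^ (1 + (p - s1) * β) := by
          rw [hl, ← Real.rpow_mul he0.le]
          nth_rewrite 2 [← Real.rpow_one e]
          rw [← Real.rpow_add he0]; congr 1; ring
        have e2 : l ^ (p - 2) * e ^ (1 + 2 * β) = e ^ (1 + p * β) := by
          rw [hl, ← Real.rpow_mul he0.le, ← Real.rpow_add he0]; congr 1; ring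
        rw [← e1, ← e2]; ring
    _ ≤ C1 * e ^ (1 + (p - s1) * β) + C3 * e ^ (1 + (p - s1) * β) := by
        gcongr C1 * e ^ (1 + (p - s1) * β) + C3 * ?_
        apply Real.rpow_le_rpow_of_exponent_ge he0 he1
        nlinarith
    _ = _ := by ring

lemma tc {V : Type*} [NormedAddCommGroup V] [NormedSpace ℝ V] [FiniteDimensional ℝ V]
    [MeasureSpace V] [BorelSpace V] [(volume : Measure V).IsAddHaarMeasure]
    (f : V → ℝ) (hf : MemLp f 2 volume) :
    Filter.Tendsto (fun z : V => eLpNorm (fun x => f (z + x) - f x) 2 volume) (nhds 0) (nhds 0) := by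
  have : Fact ((2:ENNReal) ≠ ⊤) := ⟨by norm_num⟩
  have hc : Continuous (fun z : V => (DomAddAct.mk z) +ᵥ (hf.toLp f)) := by
    have : Continuous (fun z : V => DomAddAct.mk z) := DomAddAct.continuous_mk
    exact this.vadd continuous_const
  have h0 := hc.tendsto 0
  rw [tendsto_iff_edist_tendsto_0] at h0
  refine h0.congr (fun z => ?_)
  rw [DomAddAct.mk_vadd_toLp, DomAddAct.mk_vadd_toLp, Lp.edist_toLp_toLp]
  refine eLpNorm_congr_ae (ae_of_all _ fun x => ?_)
  simp

lemma mol_le {V : Type*} [NormedAddCommGroup V] [NormedSpace ℝ V] [FiniteDimensional ℝ V]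
    [MeasureSpace V] [BorelSpace V] [(volume : Measure V).IsAddHaarMeasure]
    (f : V → ℝ) (hf : Measurable f) (ν : Measure V) [IsProbabilityMeasure ν] (e : ENNReal)
    (hi : ∀ z, Integrable (fun y => f (z - y)) ν)
    (he : ∀ᵐ y ∂ν, eLpNorm (fun x => f (-y + x) - f x) 2 volume ≤ e) :
    eLpNorm (fun z => (∫ y, f (z - y) ∂ν) - f z) 2 volume ≤ e := by
  have h2 : ∀ (μ : Measure V) (g : V → ℝ), eLpNorm g 2 μ ^ 2 = ∫⁻ x, ‖g x‖ₑ ^ 2 ∂μ := by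
    intro μ g
    have := eLpNorm_nnreal_pow_eq_lintegral (μ := μ) (f := g) (p := 2) (by norm_num)
    simpa using this
  have key : eLpNorm (fun z => (∫ y, f (z - y) ∂ν) - f z) 2 volume ^ 2 ≤ e ^ 2 := by
    rw [h2]
    calc ∫⁻ z, ‖(∫ y, f (z - y) ∂ν) - f z‖ₑ ^ 2
        ≤ ∫⁻ z, ∫⁻ y, ‖f (z - y) - f z‖ₑ ^ 2 ∂ν := by
          refine lintegral_mono (fun z => ?_)
          have e1 : (∫ y, f (z - y) ∂ν) - f z = ∫ y, (f (z - y) - f z) ∂ν := by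
            rw [integral_sub (hi z) (integrable_const _)]; simp
          have hm : Measurable (fun y => f (z - y) - f z) := by fun_prop
          rw [e1, ← h2]
          gcongr
          calc ‖∫ y, (f (z - y) - f z) ∂ν‖ₑ ≤ eLpNorm (fun y => f (z - y) - f z) 1 ν := by
                rw [eLpNorm_one_eq_lintegral_enorm]; exact enorm_integral_le_lintegral_enorm _
            _ ≤ _ := eLpNorm_le_eLpNorm_of_exponent_le (by norm_num) hm.aestronglyMeasurable
      _ = ∫⁻ y, (∫⁻ z, ‖f (z - y) - f z‖ₑ ^ 2) ∂ν := by
          rw [lintegral_lintegral_swap]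
          have : Measurable (fun p : V × V => ‖f (p.1 - p.2) - f p.1‖ₑ ^ 2) := by fun_prop
          · exact this.aemeasurable
      _ ≤ ∫⁻ y, e ^ 2 ∂ν := by
          refine lintegral_mono_ae ?_
          filter_upwards [he] with y hy
          rw [← h2]
          have : (fun z => f (z - y) - f z) = (fun x => f (-y + x) - f x) := by
            ext z; rw [neg_add_eq_sub]
          rw [this]; gcongr
      _ = e ^ 2 := by simp
  exact (ENNReal.pow_le_pow_left_iff (by norm_num)).mp key

instance instHaarSpaceTime (N : ℕ) :
    (volume : Measure (ℝ × EuclideanSpace ℝ (Fin N))).IsAddHaarMeasure :=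
  inferInstanceAs ((volume : Measure ℝ).prod
    (volume : Measure (EuclideanSpace ℝ (Fin N)))).IsAddHaarMeasure

def bmp (N n : ℕ) : ContDiffBump (0 : ℝ × EuclideanSpace ℝ (Fin N)) where
  rIn := 1 / (2 * ((n:ℝ) + 1))
  rOut := 1 / ((n:ℝ) + 1)
  rIn_pos := by positivity
  rIn_lt_rOut := by
    apply one_div_lt_one_div_of_lt <;> nlinarith [(Nat.cast_nonneg n : (0:ℝ) ≤ n)]

def rho (N n : ℕ) : ℝ × EuclideanSpace ℝ (Fin N) → ℝ := (bmp N n).normed volume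

def mol {N : ℕ} (n : ℕ) (f : ℝ × EuclideanSpace ℝ (Fin N) → ℝ)
    (z : ℝ × EuclideanSpace ℝ (Fin N)) : ℝ := ∫ t, f t * rho N n (z - t)

lemma rho_nonneg {N n : ℕ} (z) : 0 ≤ rho N n z := (bmp N n).nonneg_normed z
lemma rho_cont {N n : ℕ} : Continuous (rho N n) := (bmp N n).continuous_normed
lemma rho_contDiff {N n : ℕ} : ContDiff ℝ 1 (rho N n) := (bmp N n).contDiff_normed (n := 1)
lemma rho_cs {N n : ℕ} : HasCompactSupport (rho N n) := (bmp N n).hasCompactSupport_normed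
lemma rho_int {N n : ℕ} : ∫ z, rho N n z = 1 := (bmp N n).integral_normed
lemma rho_integrable {N n : ℕ} : Integrable (rho N n) := (bmp N n).integrable_normed
lemma rho_zero {N n : ℕ} {z : ℝ × EuclideanSpace ℝ (Fin N)} (h : 1 / ((n:ℝ) + 1) ≤ ‖z‖) :
    rho N n z = 0 := by
  have := (bmp N n).support_normed_eq (μ := volume)
  by_contra hne
  have h2 : z ∈ Function.support (rho N n) := hne
  rw [rho, this] at h2
  simp only [Metric.mem_ball, dist_zero_right] at h2
  exact absurd h2 (not_lt.mpr h)

lemma mol_swap {N n : ℕ} (f : ℝ × EuclideanSpace ℝ (Fin N) → ℝ) (z) :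
    mol n f z = ∫ y, f (z - y) * rho N n y := by
  unfold mol
  rw [← integral_sub_left_eq_self (fun y => f (z - y) * rho N n y) volume z]
  simp

lemma mol_ker_integrable {N n : ℕ} {f : ℝ × EuclideanSpace ℝ (Fin N) → ℝ}
    (hf : LocallyIntegrable f) (z) : Integrable (fun y => f (z - y) * rho N n y) := by
  have h1 : Integrable (fun t => f t * rho N n (z - t)) := by
    have := hf.integrable_smul_left_of_hasCompactSupport (g := fun t => rho N n (z - t))
      (rho_cont.comp (continuous_const.sub continuous_id))
      (rho_cs.comp_homeomorph (Homeomorph.subLeft z))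
    refine this.congr (ae_of_all _ fun t => ?_)
    simp [mul_comm]
  have := h1.comp_sub_left z
  simpa using this

lemma mol_contDiff {N n : ℕ} {f : ℝ × EuclideanSpace ℝ (Fin N) → ℝ}
    (hf : LocallyIntegrable f) : ContDiff ℝ 1 (mol n f) := by
  exact rho_cs.contDiff_convolution_right (ContinuousLinearMap.mul ℝ ℝ) hf rho_contDiff

lemma mol_nonneg {N n : ℕ} {f : ℝ × EuclideanSpace ℝ (Fin N) → ℝ} (h : ∀ z, 0 ≤ f z) (z) :
    0 ≤ mol n f z := integral_nonneg fun t => mul_nonneg (h t) (rho_nonneg _)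

lemma mol_le_const {N n : ℕ} {f : ℝ × EuclideanSpace ℝ (Fin N) → ℝ} {M : ℝ}
    (hf : LocallyIntegrable f) (h : ∀ z, f z ≤ M) (z) : mol n f z ≤ M := by
  rw [mol_swap]
  calc _ ≤ ∫ y, M * rho N n y := integral_mono (mol_ker_integrable hf z)
        (rho_integrable.const_mul M) (fun y => mul_le_mul_of_nonneg_right (h _) (rho_nonneg _))
    _ = M := by rw [integral_const_mul, rho_int, mul_one]

lemma mol_supp {N n : ℕ} {f : ℝ × EuclideanSpace ℝ (Fin N) → ℝ} {R : ℝ}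
    (h : ∀ s x, R ≤ ‖x‖ → f (s, x) = 0) (s x) (hx : R + 1 ≤ ‖x‖) : mol n f (s, x) = 0 := by
  rw [mol_swap]
  rw [← integral_zero (ℝ × EuclideanSpace ℝ (Fin N)) ℝ]
  congr 1; ext y
  by_cases hy : 1 / ((n:ℝ) + 1) ≤ ‖y‖
  · rw [rho_zero hy, mul_zero]
  · push Not at hy
    have h1 : 1 / ((n:ℝ) + 1) ≤ 1 := by
      rw [div_le_one (by positivity)]; linarith [(Nat.cast_nonneg n : (0:ℝ) ≤ n)]
    have h2 : ‖y.2‖ ≤ ‖y‖ := norm_snd_le y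
    have h3 := norm_sub_norm_le x y.2
    have : f ((s, x) - y) = 0 := h (s - y.1) (x - y.2) (by linarith)
    rw [this, zero_mul]

lemma mol_fderiv {N n : ℕ} {W G : ℝ × EuclideanSpace ℝ (Fin N) → ℝ} {T : ℝ}
    (v : ℝ × EuclideanSpace ℝ (Fin N)) (hW : LocallyIntegrable W)
    (hw : ∀ ζ : ℝ × EuclideanSpace ℝ (Fin N) → ℝ, ContDiff ℝ 1 ζ → HasCompactSupport ζ →
      (∀ s x, s ∉ Ioo (0:ℝ) T → ζ (s, x) = 0) → ∫ z, W z * fderiv ℝ ζ z v = - ∫ z, G z * ζ z)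
    (s : ℝ) (x) (hs1 : 1 / ((n:ℝ) + 1) ≤ s) (hs2 : s ≤ T - 1 / ((n:ℝ) + 1)) :
    fderiv ℝ (mol n W) (s, x) v = mol n G (s, x) := by
  have h1 := (rho_cs (N := N) (n := n)).hasFDerivAt_convolution_right
    (ContinuousLinearMap.mul ℝ ℝ) hW rho_contDiff (s, x)
  have h2 : HasFDerivAt (mol n W) _ (s, x) := h1
  rw [h2.fderiv, convolution_precompR_apply _ hW (rho_cs.fderiv ℝ)
    (rho_contDiff.continuous_fderiv one_ne_zero)]
  have h3 := hw (fun t => rho N n ((s, x) - t)) (rho_contDiff.comp (contDiff_const.sub contDiff_id))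
    (rho_cs.comp_homeomorph (Homeomorph.subLeft (s, x))) (by
      intro s' x' hs'
      apply rho_zero
      refine le_trans ?_ (norm_fst_le _)
      simp only [Prod.fst_sub, Real.norm_eq_abs]
      simp only [mem_Ioo, not_and_or, not_lt] at hs'
      rcases hs' with h | h
      · exact le_trans (by linarith) (le_abs_self _)
      · exact le_trans (by linarith) (neg_le_abs _))
  have h4 : ∀ t, fderiv ℝ (fun t => rho N n ((s, x) - t)) t v = - fderiv ℝ (rho N n) ((s, x) - t) v := by
    intro t
    have ha : HasFDerivAt (rho N n) (fderiv ℝ (rho N n) ((s, x) - t)) ((s, x) - t) :=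
      (rho_contDiff.differentiable one_ne_zero _).hasFDerivAt
    have hb : HasFDerivAt (fun t : ℝ × EuclideanSpace ℝ (Fin N) => (s, x) - t)
      (- ContinuousLinearMap.id ℝ (ℝ × EuclideanSpace ℝ (Fin N))) t := (hasFDerivAt_id t).const_sub _
    have hc : HasFDerivAt (fun t => rho N n ((s, x) - t)) _ t := ha.comp t hb
    rw [hc.fderiv]
    simp
  simp only [h4, mul_neg, integral_neg, neg_inj] at h3
  exact h3

lemma mol_tendsto {N : ℕ} {f : ℝ × EuclideanSpace ℝ (Fin N) → ℝ} (hf : Measurable f)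
    (hf2 : MemLp f 2) : Filter.Tendsto (fun n => eLpNorm (fun z => mol n f z - f z) 2 volume)
      Filter.atTop (nhds 0) := by
  have hl : LocallyIntegrable f := hf2.locallyIntegrable (by norm_num)
  have h := tc f hf2
  rw [ENNReal.tendsto_nhds_zero] at h
  rw [ENNReal.tendsto_nhds_zero]
  intro e he
  obtain ⟨δ, hδ, hb⟩ := Metric.eventually_nhds_iff.mp (h e he)
  filter_upwards [(tendsto_one_div_add_atTop_nhds_zero_nat (𝕜 := ℝ)).eventually (gt_mem_nhds hδ)]
    with n hn
  let ν : Measure (ℝ × EuclideanSpace ℝ (Fin N)) :=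
    volume.withDensity (fun z => ENNReal.ofReal (rho N n z))
  have hν : IsProbabilityMeasure ν := by
    constructor
    rw [withDensity_apply _ MeasurableSet.univ, Measure.restrict_univ,
      ← ofReal_integral_eq_lintegral_ofReal rho_integrable (ae_of_all _ rho_nonneg), rho_int]
    simp
  have hmr : Measurable (rho N n) := rho_cont.measurable
  have hIe : ∀ z, mol n f z = ∫ y, f (z - y) ∂ν := by
    intro z
    rw [mol_swap, integral_withDensity_eq_integral_toReal_smul (by fun_prop)
      (ae_of_all _ fun _ => ENNReal.ofReal_lt_top)]
    congr 1; ext y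
    rw [ENNReal.toReal_ofReal (rho_nonneg y), smul_eq_mul, mul_comm]
  simp only [hIe]
  refine mol_le f hf ν e ?_ ?_
  · intro z
    rw [integrable_withDensity_iff (by fun_prop) (ae_of_all _ fun _ => ENNReal.ofReal_lt_top)]
    refine (mol_ker_integrable (n := n) hl z).congr (ae_of_all _ fun y => ?_)
    simp only
    rw [ENNReal.toReal_ofReal (rho_nonneg y)]
  · rw [ae_withDensity_iff (by fun_prop)]
    refine ae_of_all _ fun y hy => ?_
    apply hb
    rw [dist_zero_right, norm_neg]
    by_contra hc
    push Not at hc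
    exact hy (by rw [rho_zero (hn.le.trans hc)]; simp)

lemma bilin_lim {α : Type*} [MeasurableSpace α] {μ : Measure α} {a b : α → ℝ} {ak bk θk : ℕ → α → ℝ}
    {θ : α → ℝ}
    (ha : MemLp a 2 μ) (hb : MemLp b 2 μ) (hak : ∀ k, MemLp (ak k) 2 μ) (hbk : ∀ k, MemLp (bk k) 2 μ)
    (hta : Filter.Tendsto (fun k => eLpNorm (fun x => ak k x - a x) 2 μ) Filter.atTop (nhds 0))
    (htb : Filter.Tendsto (fun k => eLpNorm (fun x => bk k x - b x) 2 μ) Filter.atTop (nhds 0))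
    (hθm : ∀ k, AEStronglyMeasurable (θk k) μ) (hθ1 : ∀ k x, ‖θk k x‖ ≤ 1)
    (hθt : ∀ x, Filter.Tendsto (fun k => θk k x) Filter.atTop (nhds (θ x))) :
    Filter.Tendsto (fun k => ∫ x, θk k x * (ak k x * bk k x) ∂μ) Filter.atTop
      (nhds (∫ x, θ x * (a x * b x) ∂μ)) := by
  have hab : Integrable (fun x => a x * b x) μ := ha.integrable_mul hb
  have habk : ∀ k, Integrable (fun x => ak k x * bk k x) μ := fun k => (hak k).integrable_mul (hbk k)
  have h2 : Filter.Tendsto (fun k => ∫ x, θk k x * (a x * b x) ∂μ) Filter.atTop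
      (nhds (∫ x, θ x * (a x * b x) ∂μ)) := by
    refine tendsto_integral_of_dominated_convergence (fun x => ‖a x * b x‖)
      (fun k => (hθm k).mul hab.1) hab.norm (fun k => ae_of_all _ fun x => ?_)
      (ae_of_all _ fun x => (hθt x).mul_const _)
    rw [norm_mul]
    exact mul_le_of_le_one_left (norm_nonneg _) (hθ1 k x)
  have holder : ∀ f g : α → ℝ, MemLp f 2 μ → MemLp g 2 μ →
      eLpNorm (fun x => f x * g x) 1 μ ≤ eLpNorm f 2 μ * eLpNorm g 2 μ := by
    intro f g hf hg
    have := eLpNorm_smul_le_mul_eLpNorm (p := 2) (q := 2) (r := 1) (f := g) (φ := f) (μ := μ) hg.1 hf.1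
    exact this
  have hi1 : ∀ k, Integrable (fun x => θk k x * (ak k x * bk k x - a x * b x)) μ := fun k =>
    ((habk k).sub hab).bdd_mul (hθm k) (ae_of_all _ (hθ1 k))
  have hi2 : ∀ k, Integrable (fun x => θk k x * (a x * b x)) μ := fun k =>
    hab.bdd_mul (hθm k) (ae_of_all _ (hθ1 k))
  have h1 : Filter.Tendsto (fun k => ∫ x, θk k x * (ak k x * bk k x - a x * b x) ∂μ) Filter.atTop
      (nhds (∫ x, (0:ℝ) ∂μ)) := by
    refine tendsto_integral_of_L1' (fun _ => 0) aestronglyMeasurable_const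
      (Filter.Eventually.of_forall hi1) ?_
    have hub : Filter.Tendsto (fun k => eLpNorm (fun x => ak k x - a x) 2 μ *
        (eLpNorm (fun x => bk k x - b x) 2 μ + eLpNorm b 2 μ) +
        eLpNorm a 2 μ * eLpNorm (fun x => bk k x - b x) 2 μ) Filter.atTop (nhds 0) := by
      have hB := hb.2.ne
      have hA := ha.2.ne
      have e1 := ENNReal.Tendsto.mul hta (Or.inr (by simpa using hB)) (htb.add_const (eLpNorm b 2 μ))
        (Or.inr (by simp))
      have e2 := ENNReal.Tendsto.const_mul (a := eLpNorm a 2 μ) htb (Or.inr hA)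
      simpa using e1.add e2
    refine tendsto_of_tendsto_of_tendsto_of_le_of_le tendsto_const_nhds hub (fun _ => zero_le)
      (fun k => ?_)
    have hda : MemLp (fun x => ak k x - a x) 2 μ := (hak k).sub ha
    have hdb : MemLp (fun x => bk k x - b x) 2 μ := (hbk k).sub hb
    calc _ ≤ eLpNorm (fun x => (ak k x - a x) * bk k x + a x * (bk k x - b x)) 1 μ := by
          refine eLpNorm_mono fun x => ?_
          simp only [Pi.sub_apply, sub_zero]
          rw [norm_mul]
          refine (mul_le_of_le_one_left (norm_nonneg _) (hθ1 k x)).trans (le_of_eq ?_)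
          congr 1; ring
      _ ≤ eLpNorm (fun x => (ak k x - a x) * bk k x) 1 μ + eLpNorm (fun x => a x * (bk k x - b x)) 1 μ :=
          eLpNorm_add_le (hda.1.mul (hbk k).1) (ha.1.mul hdb.1) le_rfl
      _ ≤ _ := by
          refine add_le_add ((holder _ _ hda (hbk k)).trans ?_) (holder _ _ ha hdb)
          gcongr
          have : bk k = (fun x => bk k x - b x) + b := by ext x; simp
          conv_lhs => rw [this]
          exact eLpNorm_add_le hdb.1 hb.1 (by norm_num)
  have := h1.add h2
  simp only [integral_zero, zero_add] at this
  refine this.congr fun k => ?_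
  rw [← integral_add (hi1 k) (hi2 k)]
  congr 1; ext x; ring

lemma fderiv_shift_apply {V : Type*} [NormedAddCommGroup V] [NormedSpace ℝ V] (f : V → ℝ) (c z v : V) :
    fderiv ℝ (fun y => f (y - c)) z v = fderiv ℝ f (z - c) v := by
  rw [fderiv_comp_sub]

lemma shift_test {V : Type*} [NormedAddCommGroup V] [NormedSpace ℝ V] {f : V → ℝ}
    (hf : ContDiff ℝ 1 f) (hc : HasCompactSupport f) (c : V) :
    ContDiff ℝ 1 (fun y => f (y - c)) ∧ HasCompactSupport (fun y => f (y - c)) :=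
  ⟨hf.comp (contDiff_id.sub contDiff_const), hc.comp_homeomorph (Homeomorph.subRight c)⟩

lemma loc_mul_integrable {N : ℕ} {U f : ℝ × EuclideanSpace ℝ (Fin N) → ℝ}
    (hU : LocallyIntegrable U) (hf : Continuous f) (hc : HasCompactSupport f) :
    Integrable (fun z => U z * f z) := by
  have := hU.integrable_smul_left_of_hasCompactSupport hf hc
  exact this.congr (ae_of_all _ fun t => by simp [mul_comm])

lemma mvt_energy {N : ℕ} {U F : ℝ × EuclideanSpace ℝ (Fin N) → ℝ}
    {G : Fin N → ℝ × EuclideanSpace ℝ (Fin N) → ℝ} {T h : ℝ}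
    (hU : LocallyIntegrable U)
    (heq : ∀ ζ : ℝ × EuclideanSpace ℝ (Fin N) → ℝ, ContDiff ℝ 1 ζ → HasCompactSupport ζ →
      (∀ s x, s ∉ Ioo (0:ℝ) T → ζ (s, x) = 0) →
      ∫ z, U z * fderiv ℝ ζ z (1, 0) =
        (∑ i, ∫ z, G i z * fderiv ℝ ζ z (0, EuclideanSpace.single i 1)) + ∫ z, F z * ζ z)
    (hh : 0 < h) (ζ : ℝ × EuclideanSpace ℝ (Fin N) → ℝ) (hζ : ContDiff ℝ 1 ζ)
    (hc : HasCompactSupport ζ) (hz : ∀ s x, s ∉ Ioo (0:ℝ) (T - h) → ζ (s, x) = 0) :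
    ∃ r ∈ Ioo 0 h, ∫ z, (U ((h, 0) + z) - U z) * ζ z =
      - h * ((∑ i, ∫ z, G i ((r, 0) + z) * fderiv ℝ ζ z (0, EuclideanSpace.single i 1))
        + ∫ z, F ((r, 0) + z) * ζ z) := by
  set e : ℝ × EuclideanSpace ℝ (Fin N) := (1, 0) with he
  set J : ℝ → ℝ := fun r => ((∑ i, ∫ z, G i ((r, 0) + z) * fderiv ℝ ζ z (0, EuclideanSpace.single i 1))
        + ∫ z, F ((r, 0) + z) * ζ z) with hJ
  set ξ : ℝ × EuclideanSpace ℝ (Fin N) → ℝ := fun z => ζ (-z) with hξ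
  have hξ1 : ContDiff ℝ 1 ξ := hζ.comp contDiff_neg
  have hξc : HasCompactSupport ξ := hc.comp_homeomorph (Homeomorph.neg _)
  set I : ℝ → ℝ := fun r => ∫ z, U z * ζ (z - (r, 0)) with hI
  have hfξ : ∀ z v, fderiv ℝ ξ z v = - fderiv ℝ ζ (-z) v := by
    intro z v
    have ha : HasFDerivAt ζ (fderiv ℝ ζ (-z)) (-z) := (hζ.differentiable one_ne_zero _).hasFDerivAt
    have hb : HasFDerivAt (fun t : ℝ × EuclideanSpace ℝ (Fin N) => -t)
      (- ContinuousLinearMap.id ℝ (ℝ × EuclideanSpace ℝ (Fin N))) z := (hasFDerivAt_id z).neg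
    have hcc : HasFDerivAt ξ _ z := ha.comp z hb
    rw [hcc.fderiv]; simp
  have hsh : ∀ (f g : ℝ × EuclideanSpace ℝ (Fin N) → ℝ) (c : ℝ × EuclideanSpace ℝ (Fin N)),
      ∫ z, f z * g (z - c) = ∫ z, f (c + z) * g z := by
    intro f g c
    rw [← integral_add_left_eq_self (fun z => f z * g (z - c)) c]
    simp
  have hder : ∀ r, HasDerivAt I (- ∫ z, U z * fderiv ℝ ζ (z - (r, 0)) e) r := by
    intro r
    have h1 := hξc.hasFDerivAt_convolution_right (ContinuousLinearMap.mul ℝ ℝ) hU hξ1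
      ((r, 0) : ℝ × EuclideanSpace ℝ (Fin N))
    have h2 : HasDerivAt (fun r : ℝ => ((r, 0) : ℝ × EuclideanSpace ℝ (Fin N))) e r :=
      (hasDerivAt_id r).prodMk (hasDerivAt_const r 0)
    have h3 := h1.comp_hasDerivAt r h2
    rw [convolution_precompR_apply _ hU (hξc.fderiv ℝ) (hξ1.continuous_fderiv one_ne_zero)] at h3
    have e1 : I = (convolution U ξ (ContinuousLinearMap.mul ℝ ℝ) volume) ∘
        (fun r : ℝ => ((r, 0) : ℝ × EuclideanSpace ℝ (Fin N))) := by
      ext r'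
      simp [hI, convolution_def, hξ]
    rw [e1]
    have e2 : convolution U (fun a => (fderiv ℝ ξ a) e) (ContinuousLinearMap.mul ℝ ℝ) volume (r, 0)
        = - ∫ z, U z * fderiv ℝ ζ (z - (r, 0)) e := by
      rw [convolution_def, ← integral_neg]
      congr 1; ext z
      simp [hfξ]
    rw [← e2]
    exact h3
  have hJr : ∀ r ∈ Ioo 0 h, ∫ z, U z * fderiv ℝ ζ (z - (r, 0)) e = J r := by
    intro r hr
    have := heq (fun y => ζ (y - (r, 0))) (shift_test hζ hc (r, 0)).1 (shift_test hζ hc (r, 0)).2 (by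
        intro s x hs
        have : ((s, x) : ℝ × EuclideanSpace ℝ (Fin N)) - (r, 0) = (s - r, x) := by simp
        rw [this]
        apply hz
        simp only [mem_Ioo, not_and_or, not_lt] at hs ⊢
        rcases hs with h1 | h1
        · left; linarith [hr.1]
        · right; linarith [hr.2])
    simp only [fderiv_shift_apply] at this
    rw [this, hJ]
    simp only
    congr 1
    · refine Finset.sum_congr rfl fun i _ => ?_
      exact hsh (G i) (fun z => fderiv ℝ ζ z (0, EuclideanSpace.single i 1)) (r, 0)
    · exact hsh F ζ (r, 0)
  obtain ⟨r, hr, hs⟩ := exists_hasDerivAt_eq_slope I _ hh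
    (fun r _ => (hder r).continuousAt.continuousWithinAt) (fun r _ => hder r)
  refine ⟨r, hr, ?_⟩
  rw [hJr r hr, sub_zero] at hs
  have hI0 : I 0 = ∫ z, U z * ζ z := by
    simp only [hI]; congr 1; ext z
    congr 2; ext <;> simp
  have hIh : I h = ∫ z, U ((h, 0) + z) * ζ z := hsh U ζ (h, 0)
  have hi1 : Integrable (fun z => U ((h, 0) + z) * ζ z) := by
    have h1 : Integrable (fun z => U z * ζ (z - (h, 0))) :=
      loc_mul_integrable hU (shift_test hζ hc (h, 0)).1.continuous (shift_test hζ hc (h, 0)).2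
    have := h1.comp_add_left (h, 0)
    simpa using this
  have : ∫ z, (U ((h, 0) + z) - U z) * ζ z = I h - I 0 := by
    rw [hI0, hIh, ← integral_sub hi1 (loc_mul_integrable hU hζ.continuous hc)]
    congr 1; ext z; ring
  rw [this]
  field_simp at hs
  linarith

lemma bdd_memLp {N : ℕ} {f : ℝ × EuclideanSpace ℝ (Fin N) → ℝ} {C T R : ℝ} (hf : Measurable f)
    (hC : ∀ z, ‖f z‖ ≤ C) (h0 : ∀ s x, s ∉ Ioo (0:ℝ) T → f (s, x) = 0)
    (h1 : ∀ s x, R ≤ ‖x‖ → f (s, x) = 0) (p : ENNReal) : MemLp f p volume := by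
  set S : Set (ℝ × EuclideanSpace ℝ (Fin N)) := Ioo 0 T ×ˢ Metric.ball 0 R
  have hS : MeasurableSet S := measurableSet_Ioo.prod measurableSet_ball
  have e : f = S.indicator f := by
    ext ⟨s, x⟩
    by_cases h : (s, x) ∈ S
    · rw [indicator_of_mem h]
    · rw [indicator_of_notMem h]
      simp only [S, mem_prod, not_and_or, Metric.mem_ball, dist_zero_right, not_lt] at h
      rcases h with h | h
      · exact h0 s x h
      · exact h1 s x h
  rw [e, memLp_indicator_iff_restrict hS]
  have hb : volume S < ⊤ := by
    rw [show (volume : Measure (ℝ × EuclideanSpace ℝ (Fin N))) = volume.prod volume from rfl,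
      Measure.prod_prod]
    exact ENNReal.mul_lt_top (by simp) measure_ball_lt_top
  have : IsFiniteMeasure (volume.restrict S) := ⟨by rwa [Measure.restrict_apply_univ]⟩
  exact MemLp.of_bound hf.aestronglyMeasurable C (ae_of_all _ hC)

def thb (t1 t2 : ℝ) (ht : t1 < t2) (j : ℕ) : ContDiffBump ((t1 + t2) / 2) where
  rIn := (t2 - t1) / 2 * (1 - 1 / (2 * ((j:ℝ) + 1)))
  rOut := (t2 - t1) / 2
  rIn_pos := by
    have : 1 / (2 * ((j:ℝ) + 1)) < 1 := by
      rw [div_lt_one (by positivity)]; linarith [(Nat.cast_nonneg j : (0:ℝ) ≤ j)]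
    have h2 : 0 < (t2 - t1) / 2 := by linarith
    exact mul_pos h2 (by linarith)
  rIn_lt_rOut := by
    have : 0 < 1 / (2 * ((j:ℝ) + 1)) := by positivity
    have h2 : 0 < (t2 - t1) / 2 := by linarith
    nlinarith

lemma thb_zero {t1 t2 : ℝ} (ht : t1 < t2) (j : ℕ) {s : ℝ} (hs : s ∉ Ioo t1 t2) :
    thb t1 t2 ht j s = 0 := by
  apply ContDiffBump.zero_of_le_dist
  change (t2 - t1) / 2 ≤ dist s _
  rw [Real.dist_eq]
  simp only [mem_Ioo, not_and_or, not_lt] at hs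
  rcases hs with h | h
  · exact le_trans (by linarith) (neg_le_abs _)
  · exact le_trans (by linarith) (le_abs_self _)

lemma thb_tendsto {t1 t2 : ℝ} (ht : t1 < t2) (s : ℝ) :
    Filter.Tendsto (fun j => thb t1 t2 ht j s) Filter.atTop
      (nhds ((Ioo t1 t2).indicator (fun _ => (1:ℝ)) s)) := by
  by_cases hs : s ∈ Ioo t1 t2
  · rw [indicator_of_mem hs]
    have hlim : Filter.Tendsto (fun j : ℕ => (t2 - t1) / 2 * (1 - 1 / (2 * ((j:ℝ) + 1)))) Filter.atTop
        (nhds ((t2 - t1) / 2 * (1 - 1 / 2 * 0))) := by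
      refine Filter.Tendsto.const_mul _ (Filter.Tendsto.const_sub _ ?_)
      have := (tendsto_one_div_add_atTop_nhds_zero_nat (𝕜 := ℝ)).const_mul (1 / 2)
      refine this.congr fun j => ?_
      field_simp
    have hd : |s - (t1 + t2) / 2| < (t2 - t1) / 2 * (1 - 1 / 2 * 0) := by
      rw [abs_lt]; constructor <;> linarith [hs.1, hs.2]
    refine Filter.Tendsto.congr' ?_ tendsto_const_nhds
    filter_upwards [hlim.eventually (lt_mem_nhds hd)] with j hj
    symm
    apply ContDiffBump.one_of_mem_closedBall
    rw [Metric.mem_closedBall, Real.dist_eq]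
    exact hj.le
  · rw [indicator_of_notMem hs]
    simp only [thb_zero ht _ hs]
    exact tendsto_const_nhds

lemma test_fun {N : ℕ} {w : ℝ × EuclideanSpace ℝ (Fin N) → ℝ} (hw : ContDiff ℝ 1 w) {R : ℝ}
    (hR : ∀ s x, R ≤ ‖x‖ → w (s, x) = 0) {t1 t2 : ℝ} (ht : t1 < t2) (j : ℕ) (h : ℝ) :
    ContDiff ℝ 1 (fun z => thb t1 t2 ht j z.1 * w ((h, 0) + z)) ∧
    HasCompactSupport (fun z => thb t1 t2 ht j z.1 * w ((h, 0) + z)) ∧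
    ∀ z v, fderiv ℝ (fun z => thb t1 t2 ht j z.1 * w ((h, 0) + z)) z (0, v) =
      thb t1 t2 ht j z.1 * fderiv ℝ w ((h, 0) + z) (0, v) := by
  have h1 : ContDiff ℝ 1 (thb t1 t2 ht j) := (thb t1 t2 ht j).contDiff (n := 1)
  have h2 : ContDiff ℝ 1 (fun z : ℝ × EuclideanSpace ℝ (Fin N) => thb t1 t2 ht j z.1) :=
    h1.comp contDiff_fst
  have h3 : ContDiff ℝ 1 (fun z : ℝ × EuclideanSpace ℝ (Fin N) => w ((h, 0) + z)) :=
    hw.comp (contDiff_const.add contDiff_id)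
  refine ⟨h2.mul h3, ?_, ?_⟩
  · refine HasCompactSupport.intro (K := Icc t1 t2 ×ˢ Metric.closedBall 0 R)
      (isCompact_Icc.prod (isCompact_closedBall _ _)) ?_
    rintro ⟨s, x⟩ hz
    simp only [mem_prod, not_and_or, Metric.mem_closedBall, dist_zero_right, not_le] at hz
    rcases hz with hz | hz
    · simp only
      rw [thb_zero ht j (fun hc => hz ⟨hc.1.le, hc.2.le⟩), zero_mul]
    · have : w ((h, 0) + (s, x)) = 0 := hR _ _ (by simpa using hz.le)
      simp only
      rw [this, mul_zero]
  · intro z v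
    have d1 : HasFDerivAt (fun z : ℝ × EuclideanSpace ℝ (Fin N) => thb t1 t2 ht j z.1)
        ((fderiv ℝ (thb t1 t2 ht j) z.1).comp (ContinuousLinearMap.fst ℝ ℝ _)) z :=
      ((h1.differentiable one_ne_zero z.1).hasFDerivAt).comp z hasFDerivAt_fst
    have d2 : HasFDerivAt (fun z : ℝ × EuclideanSpace ℝ (Fin N) => w ((h, 0) + z))
        (fderiv ℝ w ((h, 0) + z)) z := by
      have := ((hw.differentiable one_ne_zero ((h, 0) + z)).hasFDerivAt).comp z
        ((hasFDerivAt_id z).const_add (h, 0))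
      simpa using! this
    have d3 : HasFDerivAt (fun z : ℝ × EuclideanSpace ℝ (Fin N) =>
      thb t1 t2 ht j z.1 * w ((h, 0) + z)) _ z := d1.mul d2
    rw [d3.fderiv]
    simp

lemma shift_memLp {N : ℕ} {f : ℝ × EuclideanSpace ℝ (Fin N) → ℝ} (hf : MemLp f 2)
    (c : ℝ × EuclideanSpace ℝ (Fin N)) : MemLp (fun z => f (c + z)) 2 :=
  hf.comp_measurePreserving (measurePreserving_add_left volume c)

lemma shift_eLpNorm {N : ℕ} {f : ℝ × EuclideanSpace ℝ (Fin N) → ℝ} (hf : MemLp f 2)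
    (c : ℝ × EuclideanSpace ℝ (Fin N)) : eLpNorm (fun z => f (c + z)) 2 volume = eLpNorm f 2 volume :=
  eLpNorm_comp_measurePreserving hf.1 (measurePreserving_add_left volume c)

lemma shift_mol_tendsto {N : ℕ} {f : ℝ × EuclideanSpace ℝ (Fin N) → ℝ} (hf : MemLp f 2)
    {g : ℕ → ℝ × EuclideanSpace ℝ (Fin N) → ℝ} (hg : ∀ k, MemLp (g k) 2)
    (hgt : Filter.Tendsto (fun k => eLpNorm (fun z => g k z - f z) 2 volume) Filter.atTop (nhds 0))
    {h : ℕ → ℝ} (hh : Filter.Tendsto h Filter.atTop (nhds 0)) :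
    Filter.Tendsto (fun k => eLpNorm (fun z => g k ((h k, 0) + z) - f z) 2 volume)
      Filter.atTop (nhds 0) := by
  have hc : Filter.Tendsto (fun k => ((h k, 0) : ℝ × EuclideanSpace ℝ (Fin N))) Filter.atTop
      (nhds 0) := by
    have := hh.prodMk_nhds (tendsto_const_nhds (x := (0 : EuclideanSpace ℝ (Fin N))))
    exact this
  have h1 := hgt.add ((tc f hf).comp hc)
  rw [add_zero] at h1
  refine tendsto_of_tendsto_of_tendsto_of_le_of_le tendsto_const_nhds h1 (fun _ => zero_le)
      (fun k => ?_)
  have hd : MemLp (fun z => g k z - f z) 2 := (hg k).sub hf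
  have e1 := shift_eLpNorm hd (h k, 0)
  simp only [Function.comp]
  rw [← e1]
  have hs : MemLp (fun z => f ((h k, 0) + z) - f z) 2 := (shift_memLp hf _).sub hf
  refine le_trans (le_of_eq ?_) (eLpNorm_add_le (shift_memLp hd (h k, 0)).1 hs.1 (by norm_num))
  congr 1; ext z; simp

lemma slab_integral {N : ℕ} {y : ℝ × EuclideanSpace ℝ (Fin N) → ℝ} (hy : Integrable y)
    {t1 t2 h : ℝ} (ht : t1 < t2) :
    ∫ z, (Ioo t1 t2).indicator (fun _ => (1:ℝ)) z.1 * (y ((h, 0) + z) - y z) =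
      ((∫ s in (0:ℝ)..(t2 + h), ∫ x, y (s, x)) - ∫ s in (0:ℝ)..t2, ∫ x, y (s, x)) -
      ((∫ s in (0:ℝ)..(t1 + h), ∫ x, y (s, x)) - ∫ s in (0:ℝ)..t1, ∫ x, y (s, x)) := by
  have hys : Integrable (fun z => y ((h, 0) + z)) := hy.comp_add_left (h, 0)
  have key : ∀ f : ℝ × EuclideanSpace ℝ (Fin N) → ℝ, Integrable f →
      ∫ z, (Ioo t1 t2).indicator (fun _ => (1:ℝ)) z.1 * f z = ∫ s in t1..t2, ∫ x, f (s, x) := by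
    intro f hf
    have hi : Integrable (fun z : ℝ × EuclideanSpace ℝ (Fin N) =>
        (Ioo t1 t2).indicator (fun _ => (1:ℝ)) z.1 * f z) := by
      refine hf.bdd_mul (c := 1) ?_ (ae_of_all _ fun z => ?_)
      · exact (((measurable_const.indicator measurableSet_Ioo).comp measurable_fst)).aestronglyMeasurable
      · by_cases hz : z.1 ∈ Ioo t1 t2 <;> simp [hz]
    rw [show (volume : Measure (ℝ × EuclideanSpace ℝ (Fin N))) = volume.prod volume from rfl] at hi ⊢
    rw [integral_prod _ hi, intervalIntegral.integral_of_le ht.le, ← integral_Ioc_eq_integral_Ioo.symm,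
      ← integral_indicator measurableSet_Ioo]
    congr 1; ext s
    by_cases hs : s ∈ Ioo t1 t2
    · simp [hs]
    · simp [hs]
  have hYi : Integrable (fun s => ∫ x, y (s, x)) := by
    rw [show (volume : Measure (ℝ × EuclideanSpace ℝ (Fin N))) = volume.prod volume from rfl] at hy
    exact hy.integral_prod_left
  have e1 : ∫ z, (Ioo t1 t2).indicator (fun _ => (1:ℝ)) z.1 * (y ((h, 0) + z) - y z) =
      (∫ z, (Ioo t1 t2).indicator (fun _ => (1:ℝ)) z.1 * y ((h, 0) + z))
      - ∫ z, (Ioo t1 t2).indicator (fun _ => (1:ℝ)) z.1 * y z := by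
    rw [← integral_sub]
    · congr 1; ext z; ring
    · refine hys.bdd_mul (c := 1) ?_ (ae_of_all _ fun z => ?_)
      · exact (((measurable_const.indicator measurableSet_Ioo).comp measurable_fst)).aestronglyMeasurable
      · by_cases hz : z.1 ∈ Ioo t1 t2 <;> simp [hz]
    · refine hy.bdd_mul (c := 1) ?_ (ae_of_all _ fun z => ?_)
      · exact (((measurable_const.indicator measurableSet_Ioo).comp measurable_fst)).aestronglyMeasurable
      · by_cases hz : z.1 ∈ Ioo t1 t2 <;> simp [hz]
  rw [e1, key _ hys, key _ hy]
  have e2 : (∫ s in t1..t2, ∫ x, y ((h, 0) + (s, x))) = ∫ s in (t1 + h)..(t2 + h), ∫ x, y (s, x) := by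
    rw [← intervalIntegral.integral_comp_add_right (fun s => ∫ x, y (s, x)) h]
    congr 1; ext s; simp [add_comm]
  rw [e2]
  have ii : ∀ a b : ℝ, IntervalIntegrable (fun s => ∫ x, y (s, x)) volume a b := fun a b =>
    hYi.intervalIntegrable
  rw [← intervalIntegral.integral_interval_sub_left (ii 0 (t2 + h)) (ii 0 (t1 + h)),
    ← intervalIntegral.integral_interval_sub_left (ii 0 t2) (ii 0 t1)]
  ring

lemma energy {N : ℕ} {U W F y : ℝ × EuclideanSpace ℝ (Fin N) → ℝ}
    {G : Fin N → ℝ × EuclideanSpace ℝ (Fin N) → ℝ} {T R : ℝ}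
    (hU2 : MemLp U 2) (hWm : Measurable W) (hW2 : MemLp W 2) (hF2 : MemLp F 2)
    (hWR : ∀ s x, R ≤ ‖x‖ → W (s, x) = 0) (hy : Integrable y)
    (hGm : ∀ i, Measurable (G i)) (hG2 : ∀ i, MemLp (G i) 2)
    (hgrad : ∀ i, ∀ ζ : ℝ × EuclideanSpace ℝ (Fin N) → ℝ, ContDiff ℝ 1 ζ → HasCompactSupport ζ →
      (∀ s x, s ∉ Ioo (0:ℝ) T → ζ (s, x) = 0) →
      ∫ z, W z * fderiv ℝ ζ z (0, EuclideanSpace.single i 1) = - ∫ z, G i z * ζ z)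
    (heq : ∀ ζ : ℝ × EuclideanSpace ℝ (Fin N) → ℝ, ContDiff ℝ 1 ζ → HasCompactSupport ζ →
      (∀ s x, s ∉ Ioo (0:ℝ) T → ζ (s, x) = 0) →
      ∫ z, U z * fderiv ℝ ζ z (1, 0) =
        (∑ i, ∫ z, G i z * fderiv ℝ ζ z (0, EuclideanSpace.single i 1)) + ∫ z, F z * ζ z)
    (hconv : ∀ z z', y z' - y z ≤ (U z' - U z) * W z')
    {t1 t2 : ℝ} (h0 : 0 < t1) (ht : t1 < t2) (hT : t2 < T)
    (hd1 : HasDerivAt (fun t => ∫ s in (0:ℝ)..t, ∫ x, y (s, x)) (∫ x, y (t1, x)) t1)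
    (hd2 : HasDerivAt (fun t => ∫ s in (0:ℝ)..t, ∫ x, y (s, x)) (∫ x, y (t2, x)) t2) :
    (∫ x, y (t2, x)) - (∫ x, y (t1, x)) ≤
      - ((∑ i, ∫ z, (Ioo t1 t2).indicator (fun _ => (1:ℝ)) z.1 * (G i z * G i z)) +
        ∫ z, (Ioo t1 t2).indicator (fun _ => (1:ℝ)) z.1 * (F z * W z)) := by
  set ind : ℝ × EuclideanSpace ℝ (Fin N) → ℝ :=
    fun z => (Ioo t1 t2).indicator (fun _ => (1:ℝ)) z.1 with hind
  set th : ℕ → ℝ × EuclideanSpace ℝ (Fin N) → ℝ := fun j z => thb t1 t2 ht j z.1 with hth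
  have hindm : AEStronglyMeasurable ind volume :=
    ((measurable_const.indicator measurableSet_Ioo).comp measurable_fst).aestronglyMeasurable
  have hthm : ∀ j, AEStronglyMeasurable (th j) volume := fun j =>
    ((thb t1 t2 ht j).continuous.comp continuous_fst).aestronglyMeasurable
  have hth1 : ∀ j z, ‖th j z‖ ≤ 1 := fun j z => by
    rw [Real.norm_eq_abs, abs_of_nonneg (ContDiffBump.nonneg _)]; exact ContDiffBump.le_one _
  have hind0 : ∀ z, 0 ≤ ind z := fun z => by
    by_cases hz : z.1 ∈ Ioo t1 t2 <;> simp [hind, hz]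
  have hind1 : ∀ z, ‖ind z‖ ≤ 1 := fun z => by
    by_cases hz : z.1 ∈ Ioo t1 t2 <;> simp [hind, hz]
  have htht : ∀ z, Filter.Tendsto (fun j => th j z) Filter.atTop (nhds (ind z)) := fun z =>
    thb_tendsto ht z.1
  have hUl : LocallyIntegrable U := hU2.locallyIntegrable (by norm_num)
  have hWl : LocallyIntegrable W := hW2.locallyIntegrable (by norm_num)
  have hGl : ∀ i, LocallyIntegrable (G i) := fun i => (hG2 i).locallyIntegrable (by norm_num)
  set h : ℕ → ℝ := fun k => (T - t2) / 2 * (1 / ((k:ℝ) + 1)) with hh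
  have hhpos : ∀ k, 0 < h k := fun k => mul_pos (by linarith) (by positivity)
  have hhle : ∀ k, h k ≤ (T - t2) / 2 := fun k => by
    have : 1 / ((k:ℝ) + 1) ≤ 1 := by
      rw [div_le_one (by positivity)]; linarith [(Nat.cast_nonneg k : (0:ℝ) ≤ k)]
    have h2 : 0 < (T - t2) / 2 := by linarith
    simp only [hh]; nlinarith
  have hht : Filter.Tendsto h Filter.atTop (nhds 0) := by
    have := (tendsto_one_div_add_atTop_nhds_zero_nat (𝕜 := ℝ)).const_mul ((T - t2) / 2)
    rw [mul_zero] at this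
    exact this
  have hDm : ∀ c, MemLp (fun z => U (c + z) - U z) 2 := fun c => (shift_memLp hU2 c).sub hU2
  have hDW : ∀ c, Integrable (fun z => (U (c + z) - U z) * W (c + z)) := fun c =>
    (hDm c).integrable_mul (shift_memLp hW2 c)
  have ex : ∀ k, ∃ n j : ℕ, k ≤ j ∧ 1 / ((n:ℝ) + 1) ≤ t1 ∧ 1 / ((n:ℝ) + 1) ≤ (T - t2) / 2 ∧
      eLpNorm (fun z => mol n W z - W z) 2 volume ≤ ENNReal.ofReal (h k ^ 2) ∧
      (∀ i, eLpNorm (fun z => mol n (G i) z - G i z) 2 volume ≤ ENNReal.ofReal (h k)) ∧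
      |∫ z, (ind z - th j z) * ((U ((h k, 0) + z) - U z) * W ((h k, 0) + z))| ≤ h k ^ 2 := by
    intro k
    have a1 := (tendsto_one_div_add_atTop_nhds_zero_nat (𝕜 := ℝ)).eventually (gt_mem_nhds h0)
    have a2 := (tendsto_one_div_add_atTop_nhds_zero_nat (𝕜 := ℝ)).eventually
      (gt_mem_nhds (show (0:ℝ) < (T - t2) / 2 by linarith))
    have a3 := ENNReal.tendsto_nhds_zero.mp (mol_tendsto hWm hW2) (ENNReal.ofReal (h k ^ 2))
      (ENNReal.ofReal_pos.mpr (pow_pos (hhpos k) 2))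
    have a4 : ∀ᶠ n in Filter.atTop, ∀ i,
        eLpNorm (fun z => mol n (G i) z - G i z) 2 volume ≤ ENNReal.ofReal (h k) := by
      rw [Filter.eventually_all]
      intro i
      exact ENNReal.tendsto_nhds_zero.mp (mol_tendsto (hGm i) (hG2 i)) _
        (ENNReal.ofReal_pos.mpr (hhpos k))
    obtain ⟨n, b1, b2, b3, b4⟩ := (a1.and (a2.and (a3.and a4))).exists
    have a5 : Filter.Tendsto (fun j => ∫ z, (ind z - th j z) * ((U ((h k, 0) + z) - U z) *
        W ((h k, 0) + z))) Filter.atTop (nhds (∫ z, (ind z - ind z) * ((U ((h k, 0) + z) - U z) *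
        W ((h k, 0) + z)))) := by
      refine tendsto_integral_of_dominated_convergence
        (fun z => 2 * ‖(U ((h k, 0) + z) - U z) * W ((h k, 0) + z)‖)
        (fun j => (hindm.sub (hthm j)).mul (hDW _).1) ((hDW _).norm.const_mul 2)
        (fun j => ae_of_all _ fun z => ?_)
        (ae_of_all _ fun z => ((htht z).const_sub _).mul_const _)
      rw [norm_mul]
      gcongr
      exact (norm_sub_le _ _).trans (by linarith [hind1 z, hth1 j z])
    simp only [sub_self, zero_mul, integral_zero] at a5
    have a6 := (a5.abs).eventually (ge_mem_nhds (show |(0:ℝ)| < h k ^ 2 by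
      rw [abs_zero]; exact pow_pos (hhpos k) 2))
    obtain ⟨j, c1, c2⟩ := (a6.and (Filter.eventually_ge_atTop k)).exists
    exact ⟨n, j, c2, b1.le, b2.le, b3, b4, c1⟩
  choose n j hkj hn1 hn2 hnW hnG hX using ex
  have hjt : Filter.Tendsto j Filter.atTop Filter.atTop :=
    Filter.tendsto_atTop_mono hkj Filter.tendsto_id
  have hofr : Filter.Tendsto (fun k => ENNReal.ofReal (h k)) Filter.atTop (nhds 0) := by
    have := ENNReal.tendsto_ofReal hht
    simpa using this
  -- mollified functions are in L²
  have hmW2 : ∀ k, MemLp (mol (n k) W) 2 := fun k => by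
    have : MemLp (fun z => mol (n k) W z - W z) 2 :=
      ⟨(mol_contDiff hWl).continuous.aestronglyMeasurable.sub hW2.1,
        (hnW k).trans_lt ENNReal.ofReal_lt_top⟩
    have h2 := this.add hW2
    refine h2.ae_eq (ae_of_all _ fun z => ?_)
    simp
  have hmG2 : ∀ i k, MemLp (mol (n k) (G i)) 2 := fun i k => by
    have : MemLp (fun z => mol (n k) (G i) z - G i z) 2 :=
      ⟨(mol_contDiff (hGl i)).continuous.aestronglyMeasurable.sub (hG2 i).1,
        (hnG k i).trans_lt ENNReal.ofReal_lt_top⟩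
    have h2 := this.add (hG2 i)
    refine h2.ae_eq (ae_of_all _ fun z => ?_)
    simp
  have hmWt : Filter.Tendsto (fun k => eLpNorm (fun z => mol (n k) W z - W z) 2 volume)
      Filter.atTop (nhds 0) := by
    have : Filter.Tendsto (fun k => ENNReal.ofReal (h k ^ 2)) Filter.atTop (nhds 0) := by
      have := ENNReal.tendsto_ofReal (hht.pow 2)
      simpa using this
    exact tendsto_of_tendsto_of_tendsto_of_le_of_le tendsto_const_nhds this (fun _ => zero_le) hnW
  have hmGt : ∀ i, Filter.Tendsto (fun k => eLpNorm (fun z => mol (n k) (G i) z - G i z) 2 volume)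
      Filter.atTop (nhds 0) := fun i =>
    tendsto_of_tendsto_of_tendsto_of_le_of_le tendsto_const_nhds hofr (fun _ => zero_le)
      (fun k => hnG k i)
  -- mean value
  have hmv : ∀ k, ∃ r ∈ Ioo 0 (h k),
      ∫ z, (U ((h k, 0) + z) - U z) * (th (j k) z * mol (n k) W ((h k, 0) + z)) =
      - h k * ((∑ i, ∫ z, th (j k) z * (G i ((r, 0) + z) * mol (n k) (G i) ((h k, 0) + z)))
        + ∫ z, th (j k) z * (F ((r, 0) + z) * mol (n k) W ((h k, 0) + z))) := by
    intro k
    obtain ⟨T1, T2, T3⟩ := test_fun (mol_contDiff (n := n k) hWl) (mol_supp hWR) ht (j k) (h k)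
    obtain ⟨r, hr, he⟩ := mvt_energy hUl heq (hhpos k) _ T1 T2 (by
      intro s x hs
      simp only
      rw [thb_zero ht, zero_mul]
      intro hc
      apply hs
      exact ⟨by linarith [hc.1], by linarith [hc.2, hhle k]⟩)
    refine ⟨r, hr, he.trans ?_⟩
    congr 2
    · refine Finset.sum_congr rfl fun i _ => ?_
      congr 1; ext z
      rw [T3]
      by_cases hz : z.1 ∈ Ioo t1 t2
      · have : fderiv ℝ (mol (n k) W) ((h k, 0) + z) (0, EuclideanSpace.single i 1) =
            mol (n k) (G i) ((h k, 0) + z) := by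
          refine mol_fderiv _ hWl (hgrad i) (h k + z.1) (0 + z.2) ?_ ?_
          · linarith [hn1 k, hz.1, hhpos k]
          · linarith [hn2 k, hz.2, hhle k]
        rw [this]; ring
      · simp only [hth, thb_zero ht (j k) hz]; ring
    · congr 1; ext z; ring
  choose r hr hmv using hmv
  have hrt : Filter.Tendsto r Filter.atTop (nhds 0) :=
    tendsto_of_tendsto_of_tendsto_of_le_of_le tendsto_const_nhds hht (fun k => (hr k).1.le)
      (fun k => (hr k).2.le)
  have htj : ∀ z, Filter.Tendsto (fun k => th (j k) z) Filter.atTop (nhds (ind z)) := fun z =>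
    (htht z).comp hjt
  have hsame : ∀ f : ℝ × EuclideanSpace ℝ (Fin N) → ℝ, Filter.Tendsto
      (fun _ : ℕ => eLpNorm (fun z => f z - f z) 2 volume) Filter.atTop (nhds 0) := fun f => by
    simp
  have hJ : Filter.Tendsto (fun k =>
      (∑ i, ∫ z, th (j k) z * (G i ((r k, 0) + z) * mol (n k) (G i) ((h k, 0) + z)))
        + ∫ z, th (j k) z * (F ((r k, 0) + z) * mol (n k) W ((h k, 0) + z))) Filter.atTop
      (nhds ((∑ i, ∫ z, ind z * (G i z * G i z)) + ∫ z, ind z * (F z * W z))) := by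
    refine Filter.Tendsto.add (tendsto_finsetSum _ fun i _ => ?_) ?_
    · exact bilin_lim (hG2 i) (hG2 i) (fun k => shift_memLp (hG2 i) _)
        (fun k => shift_memLp (hmG2 i k) _)
        (shift_mol_tendsto (hG2 i) (fun _ => hG2 i) (hsame (G i)) hrt)
        (shift_mol_tendsto (hG2 i) (hmG2 i) (hmGt i) hht) (fun k => hthm _) (fun k => hth1 _) htj
    · exact bilin_lim hF2 hW2 (fun k => shift_memLp hF2 _)
        (fun k => shift_memLp (hmW2 k) _)
        (shift_mol_tendsto hF2 (fun _ => hF2) (hsame F) hrt)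
        (shift_mol_tendsto hW2 hmW2 hmWt hht) (fun k => hthm _) (fun k => hth1 _) htj
  have hBk : ∀ k, MemLp (fun z => (h k)⁻¹ * (W ((h k, 0) + z) - mol (n k) W ((h k, 0) + z))) 2 :=
    fun k => ((shift_memLp hW2 _).sub (shift_memLp (hmW2 k) _)).const_mul _
  have hB : Filter.Tendsto (fun k => ∫ z, th (j k) z * ((U ((h k, 0) + z) - U z) *
      ((h k)⁻¹ * (W ((h k, 0) + z) - mol (n k) W ((h k, 0) + z))))) Filter.atTop
      (nhds (∫ z, ind z * ((0:ℝ) * 0))) := by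
    refine bilin_lim (a := fun _ => 0) (b := fun _ => 0) MemLp.zero MemLp.zero (fun k => hDm _)
      hBk ?_ ?_ (fun k => hthm _) (fun k => hth1 _) htj
    · simp only [sub_zero]
      exact shift_mol_tendsto hU2 (fun _ => hU2) (hsame U) hht
    · simp only [sub_zero]
      refine tendsto_of_tendsto_of_tendsto_of_le_of_le tendsto_const_nhds hofr (fun _ => zero_le)
        (fun k => ?_)
      have hd : MemLp (fun z => mol (n k) W z - W z) 2 := (hmW2 k).sub hW2
      have e1 := shift_eLpNorm hd (h k, 0)
      have e2 : eLpNorm (fun z => (h k)⁻¹ * (W ((h k, 0) + z) - mol (n k) W ((h k, 0) + z))) 2 volume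
          = ‖(h k)⁻¹‖ₑ * eLpNorm (fun z => mol (n k) W z - W z) 2 volume := by
        rw [← e1, ← eLpNorm_neg (f := fun z => mol (n k) W ((h k, 0) + z) - W ((h k, 0) + z)),
          ← eLpNorm_const_smul]
        congr 1; ext z; simp
      simp only
      rw [e2]
      calc _ ≤ ‖(h k)⁻¹‖ₑ * ENNReal.ofReal (h k ^ 2) := by gcongr; exact hnW k
        _ = ENNReal.ofReal (h k) := by
          rw [Real.enorm_eq_ofReal (inv_nonneg.mpr (hhpos k).le),
            ← ENNReal.ofReal_mul (inv_nonneg.mpr (hhpos k).le)]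
          congr 1
          have := (hhpos k).ne'
          field_simp
  have hXt : Filter.Tendsto (fun k => (h k)⁻¹ * ∫ z, (ind z - th (j k) z) *
      ((U ((h k, 0) + z) - U z) * W ((h k, 0) + z))) Filter.atTop (nhds 0) := by
    refine squeeze_zero_norm (fun k => ?_) hht
    rw [norm_mul, norm_inv, Real.norm_eq_abs, Real.norm_eq_abs, abs_of_pos (hhpos k),
      inv_mul_le_iff₀ (hhpos k)]
    exact (hX k).trans (by rw [pow_two])
  have hL : Filter.Tendsto (fun k => (h k)⁻¹ * ∫ z, ind z * (y ((h k, 0) + z) - y z)) Filter.atTop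
      (nhds ((∫ x, y (t2, x)) - (∫ x, y (t1, x)))) := by
    have hht' : Filter.Tendsto h Filter.atTop (nhdsWithin 0 {0}ᶜ) :=
      tendsto_nhdsWithin_iff.mpr ⟨hht, Filter.Eventually.of_forall fun k => (hhpos k).ne'⟩
    have q1 := (hasDerivAt_iff_tendsto_slope_zero.mp hd1).comp hht'
    have q2 := (hasDerivAt_iff_tendsto_slope_zero.mp hd2).comp hht'
    refine (q2.sub q1).congr fun k => ?_
    simp only [Function.comp, hind, smul_eq_mul]
    rw [slab_integral hy ht]; ring
  have hlim := ((hXt.add hB).sub hJ)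
  simp only [mul_zero, integral_zero, add_zero, zero_sub] at hlim
  refine le_of_tendsto_of_tendsto' hL hlim fun k => ?_
  have hp := hhpos k
  have i1 : Integrable (fun z => (ind z - th (j k) z) *
      ((U ((h k, 0) + z) - U z) * W ((h k, 0) + z))) := by
    refine (hDW _).bdd_mul (c := 2) (hindm.sub (hthm _)) (ae_of_all _ fun z => ?_)
    exact (norm_sub_le _ _).trans (by linarith [hind1 z, hth1 (j k) z])
  have i2 : Integrable (fun z => th (j k) z * ((U ((h k, 0) + z) - U z) *
      ((h k)⁻¹ * (W ((h k, 0) + z) - mol (n k) W ((h k, 0) + z))))) :=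
    ((hDm (h k, 0)).integrable_mul (hBk k)).bdd_mul (hthm _) (ae_of_all _ (hth1 _))
  have i3 : Integrable (fun z => (U ((h k, 0) + z) - U z) *
      (th (j k) z * mol (n k) W ((h k, 0) + z))) := by
    have := ((hDm (h k, 0)).integrable_mul (shift_memLp (hmW2 k) (h k, 0))).bdd_mul (hthm (j k))
      (ae_of_all _ (hth1 _))
    refine this.congr (ae_of_all _ fun z => ?_)
    simp only [Pi.mul_apply]
    ring
  have hysy : Integrable (fun z => y ((h k, 0) + z) - y z) := (hy.comp_add_left (h k, 0)).sub hy
  have i4 : Integrable (fun z => ind z * (y ((h k, 0) + z) - y z)) :=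
    hysy.bdd_mul hindm (ae_of_all _ hind1)
  have main : ∫ z, ind z * (y ((h k, 0) + z) - y z) ≤
      (∫ z, (ind z - th (j k) z) * ((U ((h k, 0) + z) - U z) * W ((h k, 0) + z))) +
      h k * (∫ z, th (j k) z * ((U ((h k, 0) + z) - U z) *
      ((h k)⁻¹ * (W ((h k, 0) + z) - mol (n k) W ((h k, 0) + z))))) +
      ∫ z, (U ((h k, 0) + z) - U z) * (th (j k) z * mol (n k) W ((h k, 0) + z)) := by
    have i12 : Integrable (fun z => (ind z - th (j k) z) *
      ((U ((h k, 0) + z) - U z) * W ((h k, 0) + z)) + h k * (th (j k) z *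
        ((U ((h k, 0) + z) - U z) *
      ((h k)⁻¹ * (W ((h k, 0) + z) - mol (n k) W ((h k, 0) + z)))))) :=
      i1.add (i2.const_mul _)
    rw [← integral_const_mul, ← integral_add i1 (i2.const_mul _), ← integral_add i12 i3]
    refine integral_mono i4 (i12.add i3) fun z => ?_
    have e1 : h k * (th (j k) z * ((U ((h k, 0) + z) - U z) *
      ((h k)⁻¹ * (W ((h k, 0) + z) - mol (n k) W ((h k, 0) + z))))) =
      th (j k) z * ((U ((h k, 0) + z) - U z) *
        (W ((h k, 0) + z) - mol (n k) W ((h k, 0) + z))) := by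
      field_simp
    change _ ≤ _ + h k * (th (j k) z * ((U ((h k, 0) + z) - U z) *
      ((h k)⁻¹ * (W ((h k, 0) + z) - mol (n k) W ((h k, 0) + z))))) + _
    rw [e1]
    have := mul_le_mul_of_nonneg_left (hconv z ((h k, 0) + z)) (hind0 z)
    refine this.trans (le_of_eq ?_)
    ring
  rw [hmv k] at main
  rw [inv_mul_le_iff₀ hp]
  refine main.trans (le_of_eq ?_)
  field_simp
  ring

lemma clm_norm_sq {N : ℕ} (L : EuclideanSpace ℝ (Fin N) →L[ℝ] ℝ) :
    ‖L‖ ^ 2 ≤ ∑ i, L (EuclideanSpace.single i 1) * L (EuclideanSpace.single i 1) := by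
  have h0 : 0 ≤ ∑ i, L (EuclideanSpace.single i 1) * L (EuclideanSpace.single i 1) :=
    Finset.sum_nonneg fun i _ => mul_self_nonneg _
  have h : ‖L‖ ≤ Real.sqrt (∑ i, L (EuclideanSpace.single i 1) * L (EuclideanSpace.single i 1)) := by
    refine L.opNorm_le_bound (Real.sqrt_nonneg _) fun v => ?_
    have e : L v = ∑ i, v i * L (EuclideanSpace.single i 1) := by
      conv_lhs => rw [← (EuclideanSpace.basisFun (Fin N) ℝ).sum_repr v]
      simp [map_sum]
    have cs := Finset.sum_mul_sq_le_sq_mul_sq Finset.univ (fun i => v i)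
      (fun i => L (EuclideanSpace.single i 1))
    rw [← e] at cs
    rw [Real.norm_eq_abs]
    apply abs_le_of_sq_le_sq' _ (by positivity) |> abs_le.mpr
    rw [mul_pow, Real.sq_sqrt h0, EuclideanSpace.norm_sq_eq]
    simp only [Real.norm_eq_abs, sq_abs, ← pow_two]
    linarith
  calc ‖L‖ ^ 2 ≤ _ := pow_le_pow_left₀ (norm_nonneg _) h 2
    _ = _ := Real.sq_sqrt h0

lemma slice_sub {N : ℕ} {ι : Type*} [Fintype ι] {d : ι → ℕ → ℝ × EuclideanSpace ℝ (Fin N) → ℝ}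
    (hd : ∀ i n, Measurable (d i n))
    (ht : ∀ i, Filter.Tendsto (fun n => eLpNorm (d i n) 2 volume) Filter.atTop (nhds 0)) :
    ∃ φ : ℕ → ℕ, StrictMono φ ∧ ∀ᵐ t : ℝ, ∀ i,
      Filter.Tendsto (fun k => eLpNorm (fun x => d i (φ k) (t, x)) 2 volume) Filter.atTop (nhds 0) := by
  have sq : ∀ {α : Type _} [MeasurableSpace α] (μ : Measure α) (f : α → ℝ),
      eLpNorm f 2 μ = (∫⁻ x, ‖f x‖ₑ ^ (2:ℝ) ∂μ) ^ (1/2:ℝ) := by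
    intro α _ μ f
    rw [eLpNorm_eq_lintegral_rpow_enorm_toReal (by norm_num) (by norm_num)]
    simp
  set A : ℕ → ℝ → ENNReal := fun n t => ∑ i, ∫⁻ x, ‖d i n (t, x)‖ₑ ^ (2:ℝ) with hA
  have hm : ∀ i n, Measurable (fun z => ‖d i n z‖ₑ ^ (2:ℝ)) := fun i n =>
    (hd i n).enorm.pow_const _
  have hAm : ∀ n, Measurable (A n) := fun n =>
    Finset.measurable_sum _ fun i _ => (hm i n).lintegral_prod_right'
  have hAi : ∀ n, ∫⁻ t, A n t = ∑ i, (eLpNorm (d i n) 2 volume) ^ (2:ℝ) := by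
    intro n
    rw [hA, lintegral_finsetSum _ fun i _ => (hm i n).lintegral_prod_right']
    refine Finset.sum_congr rfl fun i _ => ?_
    rw [sq, ← ENNReal.rpow_mul]
    norm_num
    rw [show (volume : Measure (ℝ × EuclideanSpace ℝ (Fin N))) = volume.prod volume from rfl,
      lintegral_prod]
    exact ((hd i n).enorm.pow_const _).aemeasurable
  have hA0 : Filter.Tendsto (fun n => ∫⁻ t, A n t) Filter.atTop (nhds 0) := by
    simp_rw [hAi]
    have : Filter.Tendsto (fun n => ∑ i, (eLpNorm (d i n) 2 volume) ^ (2:ℝ)) Filter.atTop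
        (nhds (∑ i : ι, (0:ENNReal) ^ (2:ℝ))) :=
      tendsto_finsetSum _ fun i _ => (ENNReal.continuous_rpow_const.tendsto _).comp (ht i)
    simpa using this
  obtain ⟨φ, hφ, hφ2⟩ := Filter.extraction_forall_of_eventually
    (P := fun k n => ∫⁻ t, A n t ≤ (2⁻¹ : ENNReal) ^ k) (fun k =>
      (ENNReal.tendsto_nhds_zero.mp hA0) _ (pos_iff_ne_zero.mpr (pow_ne_zero _ (by simp))))
  refine ⟨φ, hφ, ?_⟩
  have hs : ∫⁻ t, ∑' k, A (φ k) t ≠ ⊤ := by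
    rw [lintegral_tsum fun k => (hAm _).aemeasurable]
    refine ne_top_of_le_ne_top ?_ (ENNReal.tsum_le_tsum hφ2)
    rw [ENNReal.tsum_geometric]
    simp
  filter_upwards [ae_lt_top (Measurable.ennreal_tsum fun k => hAm (φ k)) hs] with t h i
  have h1 := ENNReal.tendsto_atTop_zero_of_tsum_ne_top h.ne
  have h2 : Filter.Tendsto (fun k => ∫⁻ x, ‖d i (φ k) (t, x)‖ₑ ^ (2:ℝ)) Filter.atTop (nhds 0) :=
    tendsto_of_tendsto_of_tendsto_of_le_of_le tendsto_const_nhds h1 (fun _ => zero_le)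
      (fun k => Finset.single_le_sum (f := fun i => ∫⁻ x, ‖d i (φ k) (t, x)‖ₑ ^ (2:ℝ))
        (fun _ _ => zero_le) (Finset.mem_univ i))
  simp_rw [sq]
  have := (ENNReal.continuous_rpow_const (y := 1/2)).tendsto 0 |>.comp h2
  rw [ENNReal.zero_rpow_of_pos (by norm_num)] at this
  exact this

lemma func_ae {N : ℕ} (hN : 1 ≤ N) {σ r p M R : ℝ} (hσ : 0 < σ) (hr : 0 < r) (hr2 : r < 2)
    (hp1 : 1 < p) (hp2 : p < 2) (hsp : (2 * σ + 2 * r) / (σ + 2) < p) (hM : 0 < M) :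
    ∃ C η : ℝ, 0 < C ∧ 0 < η ∧ ∀ (T : ℝ) (W : ℝ × EuclideanSpace ℝ (Fin N) → ℝ)
      (G : Fin N → ℝ × EuclideanSpace ℝ (Fin N) → ℝ), Measurable W → MemLp W 2 →
      (∀ z, 0 ≤ W z) → (∀ z, W z ≤ M) → (∀ s x, R ≤ ‖x‖ → W (s, x) = 0) →
      (∀ i, Measurable (G i)) → (∀ i, MemLp (G i) 2) → (∀ i s x, R ≤ ‖x‖ → G i (s, x) = 0) →
      (∀ i, ∀ ζ : ℝ × EuclideanSpace ℝ (Fin N) → ℝ, ContDiff ℝ 1 ζ → HasCompactSupport ζ →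
      (∀ s x, s ∉ Ioo (0:ℝ) T → ζ (s, x) = 0) →
      ∫ z, W z * fderiv ℝ ζ z (0, EuclideanSpace.single i 1) = - ∫ z, G i z * ζ z) →
      ∀ᵐ t : ℝ, t ∈ Ioo 0 T → ∀ e : ℝ, 0 < e → e ≤ 1 →
        (∑ i, ∫ x, G i (t, x) * G i (t, x)) + (∫ x, ‖x‖ ^ σ * W (t, x) ^ r) < e →
        ∫ x, W (t, x) ^ p ≤ C * e ^ (1 + η) := by
  obtain ⟨C, η, hC, hη, H⟩ := func_ineq (R := R + 1) hN hσ hr hr2 hp1 hp2 hsp hM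
  refine ⟨C, η, hC, hη, ?_⟩
  intro T W G hWm hW2 hW0 hWM hWR hGm hG2 hGR hgrad
  have hWl : LocallyIntegrable W := hW2.locallyIntegrable (by norm_num)
  have hGl : ∀ i, LocallyIntegrable (G i) := fun i => (hG2 i).locallyIntegrable (by norm_num)
  have hcW : ∀ n, Continuous (mol n W) := fun n => (mol_contDiff hWl).continuous
  have hcG : ∀ i n, Continuous (mol n (G i)) := fun i n => (mol_contDiff (hGl i)).continuous
  obtain ⟨φ, hφ, hae⟩ := slice_sub (ι := Option (Fin N))
    (d := fun o n z => o.elim (mol n W z - W z) (fun i => mol n (G i) z - G i z))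
    (by rintro (_ | i) n
        · exact (hcW n).measurable.sub hWm
        · exact (hcG i n).measurable.sub (hGm i))
    (by rintro (_ | i)
        · exact mol_tendsto hWm hW2
        · exact mol_tendsto (hGm i) (hG2 i))
  have hGs : ∀ᵐ t : ℝ, ∀ i, MemLp (fun x => G i (t, x)) 2 := by
    rw [ae_all_iff]
    intro i
    have h1 := (hG2 i).integrable_sq
    filter_upwards [Integrable.prod_right_ae h1] with t h
    exact (memLp_two_iff_integrable_sq
      ((hGm i).comp measurable_prodMk_left).aestronglyMeasurable).mpr h
  filter_upwards [hae, hGs] with t hae hGs htT e he0 he1 hlt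
  have hcp : ∀ f : EuclideanSpace ℝ (Fin N) → ℝ, (∀ x, R + 1 ≤ ‖x‖ → f x = 0) →
      HasCompactSupport f := fun f hf => by
    refine HasCompactSupport.intro (isCompact_closedBall (0 : EuclideanSpace ℝ (Fin N)) (R+1))
      fun x hx => hf x ?_
    simp only [Metric.mem_closedBall, dist_zero_right, not_le] at hx
    exact hx.le
  have hct : Continuous (fun x : EuclideanSpace ℝ (Fin N) => (t, x)) := by fun_prop
  have hWt : Filter.Tendsto (fun k => eLpNorm (fun x => mol (φ k) W (t, x) - W (t, x)) 2 volume)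
    Filter.atTop (nhds 0) := hae none
  have hGt : ∀ i, Filter.Tendsto (fun k => eLpNorm (fun x => mol (φ k) (G i) (t, x) - G i (t, x)) 2
    volume) Filter.atTop (nhds 0) := fun i => hae (some i)
  have hGml : ∀ n i, MemLp (fun x => mol n (G i) (t, x)) 2 := fun n i =>
    ((hcG i n).comp hct).memLp_of_hasCompactSupport (hcp _ fun x hx => mol_supp (hGR i) t x hx)
  have hGlim : Filter.Tendsto (fun k => ∑ i, ∫ x, mol (φ k) (G i) (t, x) * mol (φ k) (G i) (t, x))
      Filter.atTop (nhds (∑ i, ∫ x, G i (t, x) * G i (t, x))) := by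
    refine tendsto_finsetSum _ fun i _ => ?_
    have := bilin_lim (hGs i) (hGs i) (fun k => hGml (φ k) i) (fun k => hGml (φ k) i) (hGt i) (hGt i)
      (θk := fun _ _ => 1) (θ := fun _ => 1) (fun _ => aestronglyMeasurable_const) (by simp)
      (fun _ => tendsto_const_nhds)
    simpa only [one_mul] using this
  have hWtm : Measurable (fun x => W (t, x)) := hWm.comp measurable_prodMk_left
  obtain ⟨ψ, hψ, hψae⟩ := (tendstoInMeasure_of_tendsto_eLpNorm (p := 2) (by norm_num)
    (fun k => ((hcW (φ k)).comp hct).aestronglyMeasurable) hWtm.aestronglyMeasurable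
    hWt).exists_seq_tendsto_ae
  have dct : ∀ (w : EuclideanSpace ℝ (Fin N) → ℝ) (b : ℝ), 0 < b → Continuous w → (∀ x, 0 ≤ w x) →
      Filter.Tendsto (fun k => ∫ x, w x * mol (φ (ψ k)) W (t, x) ^ b) Filter.atTop
        (nhds (∫ x, w x * W (t, x) ^ b)) := by
    intro w b hb hw hw0
    refine tendsto_integral_of_dominated_convergence
      ((Metric.closedBall (0 : EuclideanSpace ℝ (Fin N)) (R+1)).indicator fun x => w x * M ^ b)
      (fun k => ?_) ?_ (fun k => ae_of_all _ fun x => ?_) ?_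
    · exact (hw.mul (((hcW _).comp hct).rpow_const fun x => Or.inr hb.le)).aestronglyMeasurable
    · rw [integrable_indicator_iff measurableSet_closedBall]
      exact (hw.mul continuous_const).continuousOn.integrableOn_compact (isCompact_closedBall _ _)
    · by_cases hx : x ∈ Metric.closedBall (0 : EuclideanSpace ℝ (Fin N)) (R+1)
      · rw [indicator_of_mem hx, Real.norm_of_nonneg (mul_nonneg (hw0 x)
          (Real.rpow_nonneg (mol_nonneg hW0 _) _))]
        exact mul_le_mul_of_nonneg_left (Real.rpow_le_rpow (mol_nonneg hW0 _)
          (mol_le_const hWl hWM _) hb.le) (hw0 x)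
      · rw [indicator_of_notMem hx]
        simp only [Metric.mem_closedBall, dist_zero_right, not_le] at hx
        rw [mol_supp hWR t x hx.le, Real.zero_rpow hb.ne']
        simp
    · filter_upwards [hψae] with x hx
      exact (hx.rpow_const (Or.inr hb.le)).const_mul _
  have hD := dct (fun x => ‖x‖ ^ σ) r hr (continuous_norm.rpow_const fun _ => Or.inr hσ.le)
    (fun x => by positivity)
  have hP := dct (fun _ => 1) p (by linarith) continuous_const (fun _ => zero_le_one)
  simp only [one_mul] at hP
  have hsum := (hGlim.comp hψ.tendsto_atTop).add hD
  have ev1 := hsum.eventually (gt_mem_nhds hlt)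
  have hφψ : Filter.Tendsto (fun k => φ (ψ k)) Filter.atTop Filter.atTop :=
    hφ.tendsto_atTop.comp hψ.tendsto_atTop
  have hz := (tendsto_one_div_add_atTop_nhds_zero_nat (𝕜 := ℝ)).comp hφψ
  have ev2 := hz.eventually (gt_mem_nhds htT.1)
  have ev3 := hz.eventually (gt_mem_nhds (show (0:ℝ) < T - t by linarith [htT.2]))
  refine le_of_tendsto hP ?_
  filter_upwards [ev1, ev2, ev3] with k h1 h2 h3
  simp only [Function.comp] at h1 h2 h3
  set n := φ (ψ k)
  have hfd : ∀ x v, fderiv ℝ (fun x => mol n W (t, x)) x v = fderiv ℝ (mol n W) (t, x) (0, v) := by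
    intro x v
    have d1 : HasFDerivAt (mol n W) (fderiv ℝ (mol n W) (t, x)) (t, x) :=
      ((mol_contDiff hWl).differentiable (by norm_num) _).hasFDerivAt
    have d2 : HasFDerivAt (fun x : EuclideanSpace ℝ (Fin N) => (t, x)) _ x :=
      hasFDerivAt_prodMk_right (𝕜 := ℝ) t x
    have d3 : HasFDerivAt (fun x => mol n W (t, x)) _ x := d1.comp x d2
    rw [d3.fderiv]
    simp
  have hfi : ∀ x i, fderiv ℝ (fun x => mol n W (t, x)) x (EuclideanSpace.single i 1) =
      mol n (G i) (t, x) := fun x i => by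
    rw [hfd]
    exact mol_fderiv _ hWl (hgrad i) t x h2.le (by linarith)
  refine H (fun x => mol n W (t, x)) ?_ (fun x => mol_nonneg hW0 _) (fun x => mol_le_const hWl hWM _)
    (fun x hx => mol_supp hWR t x hx) e he0 he1 ?_
  · exact (mol_contDiff hWl).comp (by fun_prop)
  · refine le_trans ?_ h1.le
    refine add_le_add ?_ le_rfl
    have hint : ∀ i, Integrable (fun x => mol n (G i) (t, x) * mol n (G i) (t, x)) := fun i =>
      (hGml n i).integrable_mul (hGml n i)
    rw [← integral_finsetSum _ fun i _ => hint i]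
    refine integral_mono_of_nonneg (ae_of_all _ fun x => by positivity)
      (integrable_finsetSum _ fun i _ => hint i) (ae_of_all _ fun x => ?_)
    refine (clm_norm_sq _).trans (le_of_eq ?_)
    simp only [hfi]

lemma slab_conv {N : ℕ} {T : ℝ} {f h : ℝ × EuclideanSpace ℝ (Fin N) → ℝ}
    (hfh : ∀ z, (Ioo (0:ℝ) T ×ˢ (univ : Set (EuclideanSpace ℝ (Fin N)))).indicator f z = h z)
    (hi : Integrable h) :
    ∫ s in Ioo (0:ℝ) T, ∫ x, f (s, x) = ∫ z, h z := by
  have hm : MeasurableSet (Ioo (0:ℝ) T ×ˢ (univ : Set (EuclideanSpace ℝ (Fin N)))) :=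
    measurableSet_Ioo.prod MeasurableSet.univ
  have e : h = (Ioo (0:ℝ) T ×ˢ (univ : Set (EuclideanSpace ℝ (Fin N)))).indicator f := by
    ext z; exact (hfh z).symm
  rw [e] at hi ⊢
  rw [integral_indicator hm]
  rw [integrable_indicator_iff hm] at hi
  have := setIntegral_prod (μ := volume) (ν := volume) f hi
  simp only [Measure.restrict_univ] at this
  exact this.symm

lemma bdd_loc {N : ℕ} {f b : ℝ × EuclideanSpace ℝ (Fin N) → ℝ} (hf : Measurable f)
    (hb : Continuous b) (h : ∀ z, ‖f z‖ ≤ b z) : LocallyIntegrable f :=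
  hb.locallyIntegrable.mono hf.aestronglyMeasurable
    (ae_of_all _ fun z => (h z).trans (le_abs_self _))

lemma test_dcont {N : ℕ} {ζ : ℝ × EuclideanSpace ℝ (Fin N) → ℝ} (h : ContDiff ℝ 1 ζ) (v) :
    Continuous (fun z => fderiv ℝ ζ z v) := (h.continuous_fderiv (by norm_num)).clm_apply continuous_const

lemma test_dcs {N : ℕ} {ζ : ℝ × EuclideanSpace ℝ (Fin N) → ℝ} (h : HasCompactSupport ζ) (v) :
    HasCompactSupport (fun z => fderiv ℝ ζ z v) := h.fderiv_apply ℝ v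

lemma u0_term {N : ℕ} {T : ℝ} (hT : 0 < T) {v : EuclideanSpace ℝ (Fin N) → ℝ}
    {ζ : ℝ × EuclideanSpace ℝ (Fin N) → ℝ} (h : ContDiff ℝ 1 ζ)
    (h0 : ∀ s x, s ∉ Ioo (0:ℝ) T → ζ (s, x) = 0)
    (hi : Integrable (fun z : ℝ × EuclideanSpace ℝ (Fin N) =>
      (Ioo (0:ℝ) T ×ˢ univ).indicator (fun z => v z.2) z * fderiv ℝ ζ z (1, 0))) :
    ∫ z : ℝ × EuclideanSpace ℝ (Fin N),
      (Ioo (0:ℝ) T ×ˢ univ).indicator (fun z => v z.2) z * fderiv ℝ ζ z (1, 0) = 0 := by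
  have := integral_prod_symm (μ := volume) (ν := volume) _ hi
  refine this.trans (integral_eq_zero_of_ae (ae_of_all _ fun x => ?_))
  simp only [Pi.zero_apply]
  have d : ∀ s, HasDerivAt (fun s => ζ (s, x)) (fderiv ℝ ζ (s, x) (1, 0)) s := fun s => by
    have d1 : HasFDerivAt ζ (fderiv ℝ ζ (s, x)) (s, x) :=
      (h.differentiable (by norm_num) _).hasFDerivAt
    have d2 : HasFDerivAt (fun s : ℝ => (s, x)) _ s := hasFDerivAt_prodMk_left (𝕜 := ℝ) s x
    have d3 : HasFDerivAt (fun s => ζ (s, x)) _ s := d1.comp s d2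
    have := d3.hasDerivAt
    simpa using this
  have ftc := intervalIntegral.integral_eq_sub_of_hasDerivAt (a := 0) (b := T) (fun s _ => d s)
    (((test_dcont h (1, 0)).comp (by fun_prop : Continuous fun s : ℝ => (s, x))).intervalIntegrable _ _)
  rw [h0 T x (by simp), h0 0 x (by simp), sub_zero,
    intervalIntegral.integral_of_le hT.le, integral_Ioc_eq_integral_Ioo] at ftc
  have e : (fun s => (Ioo (0:ℝ) T ×ˢ (univ : Set (EuclideanSpace ℝ (Fin N)))).indicator
      (fun z => v z.2) (s, x) * fderiv ℝ ζ (s, x) (1, 0)) =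
      (Ioo (0:ℝ) T).indicator (fun s => v x * fderiv ℝ ζ (s, x) (1, 0)) := by
    ext s
    by_cases hs : s ∈ Ioo (0:ℝ) T
    · rw [indicator_of_mem hs, indicator_of_mem (by exact ⟨hs, mem_univ _⟩)]
    · rw [indicator_of_notMem hs, indicator_of_notMem (fun hh => hs hh.1), zero_mul]
  rw [e, integral_indicator measurableSet_Ioo, integral_const_mul, ftc, mul_zero]

lemma grad_memLp {N : ℕ} {T : ℝ} {g : ℝ → EuclideanSpace ℝ (Fin N) → EuclideanSpace ℝ (Fin N)}
    (hg : Measurable (Function.uncurry g)) {K : Set (EuclideanSpace ℝ (Fin N))} (hK : MeasurableSet K)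
    (h : ∫⁻ s in Ioo (0:ℝ) T, ∫⁻ x in K, ENNReal.ofReal (‖g s x‖ ^ 2) < ⊤) (i : Fin N) :
    MemLp ((Ioo (0:ℝ) T ×ˢ K).indicator fun z => g z.1 z.2 i) 2 := by
  have hm : MeasurableSet (Ioo (0:ℝ) T ×ˢ K) := measurableSet_Ioo.prod hK
  have hgi : Measurable (fun z : ℝ × EuclideanSpace ℝ (Fin N) => g z.1 z.2 i) :=
    (EuclideanSpace.proj (𝕜 := ℝ) i).continuous.measurable.comp hg
  rw [memLp_indicator_iff_restrict hm, memLp_two_iff_integrable_sq hgi.aestronglyMeasurable]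
  refine ⟨(hgi.pow_const 2).aestronglyMeasurable, ?_⟩
  rw [hasFiniteIntegral_iff_enorm]
  refine lt_of_le_of_lt ?_ h
  have e : (volume : Measure (ℝ × EuclideanSpace ℝ (Fin N))).restrict (Ioo (0:ℝ) T ×ˢ K) =
      (volume.restrict (Ioo (0:ℝ) T)).prod (volume.restrict K) := by
    rw [Measure.prod_restrict]; rfl
  rw [e, lintegral_prod _ (by exact (hgi.pow_const 2).enorm.aemeasurable)]
  refine lintegral_mono fun s => lintegral_mono fun x => ?_
  rw [Real.enorm_eq_ofReal (by positivity)]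
  refine ENNReal.ofReal_le_ofReal ?_
  have := EuclideanSpace.norm_sq_eq (g s x)
  rw [this]
  refine le_trans (le_of_eq ?_) (Finset.single_le_sum (f := fun i => ‖g s x i‖ ^ 2)
    (fun _ _ => by positivity) (Finset.mem_univ i))
  simp

lemma grad_loc {N : ℕ} {T : ℝ} {g : ℝ → EuclideanSpace ℝ (Fin N) → EuclideanSpace ℝ (Fin N)}
    (hg : Measurable (Function.uncurry g))
    (h : ∀ K : Set (EuclideanSpace ℝ (Fin N)), IsCompact K →
        ∫⁻ s in Ioo (0:ℝ) T, ∫⁻ x in K, ENNReal.ofReal (‖g s x‖ ^ 2) < ⊤) (i : Fin N) :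
    LocallyIntegrable ((Ioo (0:ℝ) T ×ˢ (univ : Set (EuclideanSpace ℝ (Fin N)))).indicator
      fun z => g z.1 z.2 i) := by
  rw [locallyIntegrable_iff]
  intro K hK
  obtain ⟨r, hr⟩ := hK.isBounded.subset_closedBall 0
  have h1 := (grad_memLp hg measurableSet_closedBall (h _ (isCompact_closedBall 0 r)) i)
  have h2 := (h1.locallyIntegrable (by norm_num)).integrableOn_isCompact hK
  refine h2.congr_fun (fun z hz => ?_) hK.measurableSet
  have hz2 := hr hz
  have hz3 : z.2 ∈ Metric.closedBall (0 : EuclideanSpace ℝ (Fin N)) r := by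
    simp only [Metric.mem_closedBall, dist_zero_right] at hz2 ⊢
    exact (norm_snd_le z).trans hz2
  by_cases hs : z.1 ∈ Ioo (0:ℝ) T
  · rw [indicator_of_mem (by exact ⟨hs, hz3⟩), indicator_of_mem (by exact ⟨hs, mem_univ _⟩)]
  · rw [indicator_of_notMem (fun hh => hs hh.1), indicator_of_notMem (fun hh => hs hh.1)]

lemma reduce {N : ℕ} {m q σ R T C : ℝ} (hm : 1 < m) (hq : 0 < q) (hσ : 0 < σ) (hT : 0 < T)
    {u0 : EuclideanSpace ℝ (Fin N) → ℝ} {C0 : ℝ} (hu0m : Measurable u0) (hu00 : ∀ x, 0 ≤ u0 x)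
    (hu0C : ∀ x, u0 x ≤ C0)
    {u : ℝ → EuclideanSpace ℝ (Fin N) → ℝ} (hum : Measurable (Function.uncurry u))
    (hun : ∀ t x, 0 ≤ u t x) (huC : ∀ t x, u t x ≤ C)
    (hloc : ∀ᵐ t : ℝ, 0 < t → ∀ᵐ x : EuclideanSpace ℝ (Fin N), R ≤ ‖x‖ → u t x = 0)
    {g : ℝ → EuclideanSpace ℝ (Fin N) → EuclideanSpace ℝ (Fin N)}
    (hgm : Measurable (Function.uncurry g))
    (hg2 : ∀ K : Set (EuclideanSpace ℝ (Fin N)), IsCompact K →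
        ∫⁻ s in Ioo (0:ℝ) T, ∫⁻ x in K, ENNReal.ofReal (‖g s x‖ ^ 2) < ⊤)
    (hgrad : ∀ ζ : ℝ × EuclideanSpace ℝ (Fin N) → ℝ, ContDiff ℝ 1 ζ →
        HasCompactSupport ζ → (∀ s x, s ∉ Ioo (0:ℝ) T → ζ (s, x) = 0) →
        ∀ i : Fin N,
          (∫ s in Ioo (0:ℝ) T, ∫ x,
              (u s x) ^ m * fderiv ℝ ζ (s, x) (0, EuclideanSpace.single i 1))
            = - ∫ s in Ioo (0:ℝ) T, ∫ x, g s x i * ζ (s, x))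
    (heq : ∀ ζ : ℝ × EuclideanSpace ℝ (Fin N) → ℝ, ContDiff ℝ 1 ζ →
        HasCompactSupport ζ → (∀ s x, T ≤ s → ζ (s, x) = 0) →
        ∫ s in Ioo (0:ℝ) T, ∫ x,
            ((u0 x - u s x) * fderiv ℝ ζ (s, x) (1, 0)
              + fderiv ℝ ζ (s, x) (0, g s x)
              + ‖x‖ ^ σ * (u s x) ^ q * ζ (s, x)) = 0) :
    ∃ U : ℝ × EuclideanSpace ℝ (Fin N) → ℝ, ∃ G : Fin N → ℝ × EuclideanSpace ℝ (Fin N) → ℝ,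
      Measurable U ∧ (∀ z, 0 ≤ U z) ∧ (∀ z, U z ≤ C) ∧ (∀ s x, s ∉ Ioo (0:ℝ) T → U (s, x) = 0) ∧
      (∀ s x, R + 1 ≤ ‖x‖ → U (s, x) = 0) ∧
      (∀ i, Measurable (G i)) ∧ (∀ i, MemLp (G i) 2) ∧ (∀ i s x, R + 1 ≤ ‖x‖ → G i (s, x) = 0) ∧
      (∀ i, ∀ ζ : ℝ × EuclideanSpace ℝ (Fin N) → ℝ, ContDiff ℝ 1 ζ → HasCompactSupport ζ →
      (∀ s x, s ∉ Ioo (0:ℝ) T → ζ (s, x) = 0) →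
      ∫ z, U z ^ m * fderiv ℝ ζ z (0, EuclideanSpace.single i 1) = - ∫ z, G i z * ζ z) ∧
      (∀ ζ : ℝ × EuclideanSpace ℝ (Fin N) → ℝ, ContDiff ℝ 1 ζ → HasCompactSupport ζ →
      (∀ s x, s ∉ Ioo (0:ℝ) T → ζ (s, x) = 0) →
      ∫ z, U z * fderiv ℝ ζ z (1, 0) =
        (∑ i, ∫ z, G i z * fderiv ℝ ζ z (0, EuclideanSpace.single i 1)) +
          ∫ z, (‖z.2‖ ^ σ * U z ^ q) * ζ z) ∧
      (∀ᵐ t : ℝ, t ∈ Ioo 0 T → ∀ᵐ x, u t x = U (t, x)) := by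
  classical
  set A : Set (ℝ × EuclideanSpace ℝ (Fin N)) := Ioo (0:ℝ) T ×ˢ univ with hA
  set S : Set (ℝ × EuclideanSpace ℝ (Fin N)) := Ioo (0:ℝ) T ×ˢ Metric.ball 0 (R+1) with hS
  have hAm : MeasurableSet A := measurableSet_Ioo.prod MeasurableSet.univ
  have hSm : MeasurableSet S := measurableSet_Ioo.prod measurableSet_ball
  have hSA : S ⊆ A := fun z hz => ⟨hz.1, mem_univ _⟩
  have hC0 : 0 ≤ C := (hun 0 0).trans (huC 0 0)
  set uf : ℝ × EuclideanSpace ℝ (Fin N) → ℝ := A.indicator fun z => u z.1 z.2 with huf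
  set U : ℝ × EuclideanSpace ℝ (Fin N) → ℝ := S.indicator fun z => u z.1 z.2 with hU
  set Gf : Fin N → ℝ × EuclideanSpace ℝ (Fin N) → ℝ := fun i => A.indicator fun z => g z.1 z.2 i
    with hGf
  set G : Fin N → ℝ × EuclideanSpace ℝ (Fin N) → ℝ := fun i => S.indicator fun z => g z.1 z.2 i
    with hG
  have hgi : ∀ i, Measurable (fun z : ℝ × EuclideanSpace ℝ (Fin N) => g z.1 z.2 i) := fun i =>
    (EuclideanSpace.proj (𝕜 := ℝ) i).continuous.measurable.comp hgm
  have hufm : Measurable uf := Measurable.indicator hum hAm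
  have hUm : Measurable U := Measurable.indicator hum hSm
  have huf0 : ∀ z, 0 ≤ uf z := fun z => indicator_nonneg (fun z _ => hun z.1 z.2) z
  have hU0 : ∀ z, 0 ≤ U z := fun z => indicator_nonneg (fun z _ => hun z.1 z.2) z
  have hufC : ∀ z, uf z ≤ C := fun z => indicator_apply_le' (fun _ => huC _ _) (fun _ => hC0)
  have hUC : ∀ z, U z ≤ C := fun z => indicator_apply_le' (fun _ => huC _ _) (fun _ => hC0)
  have hbig : ∀ᵐ z : ℝ × EuclideanSpace ℝ (Fin N), 0 < z.1 → R ≤ ‖z.2‖ → u z.1 z.2 = 0 := by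
    have hms : MeasurableSet {z : ℝ × EuclideanSpace ℝ (Fin N) |
        0 < z.1 → R ≤ ‖z.2‖ → u z.1 z.2 = 0} := by
      have h1 : MeasurableSet {z : ℝ × EuclideanSpace ℝ (Fin N) | 0 < z.1} :=
        measurableSet_lt measurable_const measurable_fst
      have h2 : MeasurableSet {z : ℝ × EuclideanSpace ℝ (Fin N) | R ≤ ‖z.2‖} :=
        measurableSet_le measurable_const measurable_snd.norm
      have h3 : MeasurableSet {z : ℝ × EuclideanSpace ℝ (Fin N) | u z.1 z.2 = 0} :=
        hum (measurableSet_singleton 0)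
      exact h1.imp (h2.imp h3)
    refine (Measure.ae_prod_iff_ae_ae hms).mpr ?_
    filter_upwards [hloc] with t ht
    by_cases h : 0 < t
    · filter_upwards [ht h] with x hx _ using hx
    · exact ae_of_all _ fun x hx => absurd hx h
  have hUuf : ∀ᵐ z, uf z = U z := by
    filter_upwards [hbig] with z hz
    by_cases h1 : z ∈ S
    · rw [hU, huf, indicator_of_mem h1, indicator_of_mem (hSA h1)]
    · rw [hU, huf, indicator_of_notMem h1]
      by_cases h2 : z ∈ A
      · rw [indicator_of_mem h2]
        refine hz h2.1.1 ?_
        by_contra h3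
        exact h1 ⟨h2.1, by simp only [Metric.mem_ball, dist_zero_right]; linarith⟩
      · rw [indicator_of_notMem h2]
  have hGfl : ∀ i, LocallyIntegrable (Gf i) := fun i => grad_loc hgm hg2 i
  have hufml : LocallyIntegrable (fun z => uf z ^ m) := by
    refine bdd_loc (b := fun _ => C ^ m) (hufm.pow_const _) continuous_const fun z => ?_
    rw [Real.norm_of_nonneg (Real.rpow_nonneg (huf0 z) _)]
    exact Real.rpow_le_rpow (huf0 z) (hufC z) (by linarith)
  have hufl : LocallyIntegrable uf := by
    refine bdd_loc (b := fun _ => C) hufm continuous_const fun z => ?_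
    rw [Real.norm_of_nonneg (huf0 z)]
    exact hufC z
  have hu0l : LocallyIntegrable (A.indicator fun z => u0 z.2) := by
    refine bdd_loc (b := fun _ => C0) ((hu0m.comp measurable_snd).indicator hAm)
      continuous_const fun z => ?_
    rw [Real.norm_of_nonneg (indicator_nonneg (fun z _ => hu00 z.2) z)]
    exact indicator_apply_le' (fun _ => hu0C _) (fun _ => (hu00 0).trans (hu0C 0))
  have hFl : LocallyIntegrable (fun z => ‖z.2‖ ^ σ * uf z ^ q) := by
    refine bdd_loc (b := fun z => ‖z.2‖ ^ σ * C ^ q) ((measurable_snd.norm.pow_const _).mul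
      (hufm.pow_const _)) ?_ fun z => ?_
    · exact (continuous_snd.norm.rpow_const fun _ => Or.inr hσ.le).mul continuous_const
    · rw [Real.norm_of_nonneg (mul_nonneg (by positivity) (Real.rpow_nonneg (huf0 z) _))]
      exact mul_le_mul_of_nonneg_left (Real.rpow_le_rpow (huf0 z) (hufC z) hq.le) (by positivity)
  have gradf : ∀ i, ∀ ζ : ℝ × EuclideanSpace ℝ (Fin N) → ℝ, ContDiff ℝ 1 ζ → HasCompactSupport ζ →
      (∀ s x, s ∉ Ioo (0:ℝ) T → ζ (s, x) = 0) →
      ∫ z, uf z ^ m * fderiv ℝ ζ z (0, EuclideanSpace.single i 1) = - ∫ z, Gf i z * ζ z := by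
    intro i ζ h1 h2 h3
    have := hgrad ζ h1 h2 h3 i
    rw [slab_conv (f := fun z => u z.1 z.2 ^ m * fderiv ℝ ζ z (0, EuclideanSpace.single i 1))
      (h := fun z => uf z ^ m * fderiv ℝ ζ z (0, EuclideanSpace.single i 1)) ?_
      (loc_mul_integrable hufml (test_dcont h1 _) (test_dcs h2 _)),
      slab_conv (f := fun z => g z.1 z.2 i * ζ z) (h := fun z => Gf i z * ζ z) ?_
      (loc_mul_integrable (hGfl i) h1.continuous h2)] at this
    · exact this
    · intro z
      rw [← hA]
      by_cases hz : z ∈ A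
      · simp only [hGf, indicator_of_mem hz]
      · simp only [hGf, indicator_of_notMem hz, zero_mul]
    · intro z
      rw [← hA]
      by_cases hz : z ∈ A
      · simp only [huf, indicator_of_mem hz]
      · simp only [huf, indicator_of_notMem hz, Real.zero_rpow (by linarith : m ≠ 0), zero_mul]
  have hO : IsOpen (Ioo (0:ℝ) T ×ˢ (Metric.closedBall (0 : EuclideanSpace ℝ (Fin N)) R)ᶜ) :=
    isOpen_Ioo.prod Metric.isClosed_closedBall.isOpen_compl
  have hGz : ∀ i, ∀ᵐ z, z ∈ (Ioo (0:ℝ) T ×ˢ (Metric.closedBall (0 : EuclideanSpace ℝ (Fin N)) R)ᶜ) →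
      Gf i z = 0 := by
    intro i
    refine hO.ae_eq_zero_of_integral_contDiff_smul_eq_zero ((hGfl i).locallyIntegrableOn _) ?_
    intro ζ h1 h2 h3
    have h1' : ContDiff ℝ 1 ζ := h1.of_le (by exact_mod_cast le_top)
    have h4 : ∀ s x, s ∉ Ioo (0:ℝ) T → ζ (s, x) = 0 := fun s x hs => by
      apply image_eq_zero_of_notMem_tsupport
      exact fun hh => hs (h3 hh).1
    have := gradf i ζ h1' h2 h4
    have e : ∫ z, uf z ^ m * fderiv ℝ ζ z (0, EuclideanSpace.single i 1) = 0 := by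
      refine integral_eq_zero_of_ae ?_
      filter_upwards [hbig] with z hz
      simp only [Pi.zero_apply]
      by_cases hzt : z ∈ tsupport ζ
      · have hz2 := h3 hzt
        have : uf z = 0 := by
          rw [huf, indicator_of_mem (by exact ⟨hz2.1, mem_univ _⟩)]
          refine hz hz2.1.1 ?_
          have := hz2.2
          simp only [mem_compl_iff, Metric.mem_closedBall, dist_zero_right, not_le] at this
          exact this.le
        rw [this, Real.zero_rpow (by linarith), zero_mul]
      · have : fderiv ℝ ζ z = 0 := by
          apply image_eq_zero_of_notMem_tsupport
          exact fun hh => hzt (tsupport_fderiv_subset ℝ hh)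
        rw [this]; simp
    rw [e] at this
    simp only [smul_eq_mul, mul_comm (ζ _)]
    linarith
  have hGG : ∀ i, ∀ᵐ z, Gf i z = G i z := by
    intro i
    filter_upwards [hGz i] with z hz
    by_cases h1 : z ∈ S
    · simp only [hG, hGf, indicator_of_mem h1, indicator_of_mem (hSA h1)]
    · by_cases h2 : z ∈ A
      · rw [hz]
        · simp only [hG, indicator_of_notMem h1]
        · refine ⟨h2.1, ?_⟩
          intro h3
          simp only [Metric.mem_closedBall, dist_zero_right] at h3
          exact h1 ⟨h2.1, by simp only [Metric.mem_ball, dist_zero_right]; linarith⟩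
      · simp only [hG, hGf, indicator_of_notMem h1, indicator_of_notMem h2]
  have hSn : ∀ s x, R + 1 ≤ ‖x‖ → (s, x) ∉ S := fun s x hx hh => by
    have := hh.2
    simp only [Metric.mem_ball, dist_zero_right] at this
    linarith
  refine ⟨U, G, hUm, hU0, hUC, fun s x hs => indicator_of_notMem (fun hh => hs hh.1) _,
    fun s x hx => indicator_of_notMem (hSn s x hx) _, fun i => (hgi i).indicator hSm, fun i => ?_,
    fun i s x hx => indicator_of_notMem (hSn s x hx) _, ?_, ?_, ?_⟩
  · refine grad_memLp hgm measurableSet_ball (lt_of_le_of_lt (lintegral_mono fun s => ?_)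
      (hg2 _ (isCompact_closedBall 0 (R+1)))) i
    exact lintegral_mono_set Metric.ball_subset_closedBall
  · intro i ζ h1 h2 h3
    have := gradf i ζ h1 h2 h3
    have e1 : ∫ z, U z ^ m * fderiv ℝ ζ z (0, EuclideanSpace.single i 1) =
        ∫ z, uf z ^ m * fderiv ℝ ζ z (0, EuclideanSpace.single i 1) := by
      refine integral_congr_ae ?_
      filter_upwards [hUuf] with z hz
      rw [hz]
    have e2 : ∫ z, G i z * ζ z = ∫ z, Gf i z * ζ z := by
      refine integral_congr_ae ?_
      filter_upwards [hGG i] with z hz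
      rw [hz]
    rw [e1, e2, this]
  · intro ζ h1 h2 h3
    have h := heq ζ h1 h2 (fun s x hs => h3 s x fun hh => absurd hh.2 (not_lt.mpr hs))
    have j0 := loc_mul_integrable hu0l (test_dcont h1 (1, 0)) (test_dcs h2 (1, 0))
    have j1 := loc_mul_integrable hufl (test_dcont h1 (1, 0)) (test_dcs h2 (1, 0))
    have j2 : ∀ i, Integrable (fun z => Gf i z * fderiv ℝ ζ z (0, EuclideanSpace.single i 1)) :=
      fun i => loc_mul_integrable (hGfl i) (test_dcont h1 _) (test_dcs h2 _)
    have j3 := loc_mul_integrable hFl h1.continuous h2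
    have j2s : Integrable (fun z => ∑ i, Gf i z * fderiv ℝ ζ z (0, EuclideanSpace.single i 1)) :=
      integrable_finsetSum _ fun i _ => j2 i
    have j01 : Integrable (fun z => A.indicator (fun z => u0 z.2) z * fderiv ℝ ζ z (1, 0) -
      uf z * fderiv ℝ ζ z (1, 0)) := j0.sub j1
    have j012 : Integrable (fun z => A.indicator (fun z => u0 z.2) z * fderiv ℝ ζ z (1, 0) -
      uf z * fderiv ℝ ζ z (1, 0) + ∑ i, Gf i z * fderiv ℝ ζ z (0, EuclideanSpace.single i 1)) :=
      j01.add j2s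
    rw [slab_conv (f := fun z => ((u0 z.2 - u z.1 z.2) * fderiv ℝ ζ z (1, 0)
              + fderiv ℝ ζ z (0, g z.1 z.2)
              + ‖z.2‖ ^ σ * (u z.1 z.2) ^ q * ζ z))
      (h := fun z => A.indicator (fun z => u0 z.2) z * fderiv ℝ ζ z (1, 0) -
      uf z * fderiv ℝ ζ z (1, 0) + (∑ i, Gf i z * fderiv ℝ ζ z (0, EuclideanSpace.single i 1)) +
      (‖z.2‖ ^ σ * uf z ^ q) * ζ z) ?_ (j012.add j3), integral_add j012 j3, integral_add j01 j2s,
      integral_sub j0 j1, u0_term hT h1 h3 j0, integral_finsetSum _ fun i _ => j2 i] at h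
    · have e1 : ∫ z, U z * fderiv ℝ ζ z (1, 0) = ∫ z, uf z * fderiv ℝ ζ z (1, 0) := by
        refine integral_congr_ae ?_
        filter_upwards [hUuf] with z hz
        rw [hz]
      have e2 : ∀ i, ∫ z, G i z * fderiv ℝ ζ z (0, EuclideanSpace.single i 1) =
          ∫ z, Gf i z * fderiv ℝ ζ z (0, EuclideanSpace.single i 1) := fun i => by
        refine integral_congr_ae ?_
        filter_upwards [hGG i] with z hz
        rw [hz]
      have e3 : ∫ z, (‖z.2‖ ^ σ * U z ^ q) * ζ z = ∫ z, (‖z.2‖ ^ σ * uf z ^ q) * ζ z := by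
        refine integral_congr_ae ?_
        filter_upwards [hUuf] with z hz
        rw [hz]
      rw [e1, e3, Finset.sum_congr rfl fun i _ => e2 i]
      linarith
    · intro z
      rw [← hA]
      by_cases hz : z ∈ A
      · simp only [huf, hGf, indicator_of_mem hz]
        have : fderiv ℝ ζ z (0, g z.1 z.2) =
            ∑ i, g z.1 z.2 i * fderiv ℝ ζ z (0, EuclideanSpace.single i 1) := by
          have e : g z.1 z.2 = ∑ i, g z.1 z.2 i • EuclideanSpace.single i (1:ℝ) := by
            conv_lhs => rw [← (EuclideanSpace.basisFun (Fin N) ℝ).sum_repr (g z.1 z.2)]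
            simp
          have l : ∀ v, fderiv ℝ ζ z (0, v) =
            (fderiv ℝ ζ z).comp (ContinuousLinearMap.inr ℝ ℝ (EuclideanSpace ℝ (Fin N))) v := by
            intro v; simp
          rw [l]
          conv_lhs => rw [e]
          rw [map_sum]
          simp only [map_smul, smul_eq_mul, l]
        rw [this]; ring
      · simp only [huf, hGf, indicator_of_notMem hz, Real.zero_rpow hq.ne', zero_mul, mul_zero,
          Finset.sum_const_zero, sub_zero, add_zero]
  · have := Measure.ae_ae_of_ae_prod (μ := volume) (ν := volume) hUuf
    filter_upwards [this] with t ht htT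
    filter_upwards [ht] with x hx
    rw [← hx, huf, indicator_of_mem (by exact ⟨htT, mem_univ _⟩)]

lemma exists_good {P : ℝ → Prop} {T a b : ℝ} (hP : ∀ᵐ t : ℝ, t ∈ Ioo (0:ℝ) T → P t)
    (ha : 0 ≤ a) (hab : a < b) (hb : b ≤ T) : ∃ t ∈ Ioo a b, P t := by
  by_contra h
  push Not at h
  have h1 : Ioo a b ⊆ {t | ¬ (t ∈ Ioo (0:ℝ) T → P t)} := fun t ht hh =>
    h t ht (hh ⟨by linarith [ht.1], by linarith [ht.2]⟩)
  have h2 := measure_mono_null h1 (ae_iff.mp hP)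
  rw [Real.volume_Ioo, ENNReal.ofReal_eq_zero] at h2
  linarith

lemma ode_step {Y E : ℝ → ℝ} {P : ℝ → Prop} {T K η B a e t : ℝ}
    (hP : ∀ᵐ t : ℝ, t ∈ Ioo (0:ℝ) T → P t) (hY : ∀ t, 0 ≤ Y t) (hE : ∀ t, 0 ≤ E t)
    (hEi : Integrable E)
    (hen : ∀ t1 t2, P t1 → P t2 → 0 < t1 → t1 < t2 → t2 < T →
      Y t2 - Y t1 ≤ - ∫ s in Ioo t1 t2, E s)
    (hfn : ∀ᵐ t : ℝ, t ∈ Ioo (0:ℝ) T → ∀ e : ℝ, 0 < e → e ≤ 1 → E t < e → Y t ≤ K * e ^ (1 + η))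
    (ha : 0 ≤ a) (hB : 0 ≤ B) (hYB : ∀ s, P s → a < s → s < T → Y s ≤ B)
    (he : 0 < e) (he1 : e ≤ 1) (ht : a + B / e < t) (htT : t < T) (hPt : P t) :
    Y t ≤ K * e ^ (1 + η) := by
  by_contra hc
  push Not at hc
  have hBe : 0 ≤ B / e := by positivity
  obtain ⟨t1, ht1, hPt1⟩ := exists_good hP ha (show a < t - B / e by linarith) (by linarith)
  have h1t : t1 < t := by linarith [ht1.2]
  have h01 : 0 < t1 := by linarith [ht1.1]
  have hen1 := hen t1 t hPt1 hPt h01 h1t htT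
  have hlow : e * (t - t1) ≤ ∫ s in Ioo t1 t, E s := by
    have : ∫ s in Ioo t1 t, e = e * (t - t1) := by
      simp [h1t.le, mul_comm]
    rw [← this]
    refine setIntegral_mono_on_ae (integrableOn_const (by simp)) hEi.integrableOn
      measurableSet_Ioo ?_
    filter_upwards [hP, hfn] with s hs1 hs2 hs
    have hs0 : s ∈ Ioo (0:ℝ) T := ⟨by linarith [hs.1], by linarith [hs.2]⟩
    by_contra hlt
    push Not at hlt
    have h3 := hs2 hs0 e he he1 hlt
    have h4 := hen s t (hs1 hs0) hPt hs0.1 hs.2 htT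
    have h5 : 0 ≤ ∫ s in Ioo s t, E s := integral_nonneg hE
    linarith
  have h6 := hYB t1 hPt1 ht1.1 (by linarith)
  have h7 : B < e * (t - t1) := by
    have : B / e < t - t1 := by linarith [ht1.2]
    rwa [div_lt_iff₀' he] at this
  linarith [hY t]

lemma ode (K η Ym : ℝ) (hK : 0 < K) (hη : 0 < η) (hYm : 0 ≤ Ym) :
    ∃ Te : ℝ, 0 < Te ∧ ∀ (T : ℝ) (Y E : ℝ → ℝ) (P : ℝ → Prop),
    (∀ᵐ t : ℝ, t ∈ Ioo (0:ℝ) T → P t) → (∀ t, 0 ≤ Y t) → (∀ t, Y t ≤ Ym) → (∀ t, 0 ≤ E t) →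
    Integrable E →
    (∀ t1 t2, P t1 → P t2 → 0 < t1 → t1 < t2 → t2 < T →
      Y t2 - Y t1 ≤ - ∫ s in Ioo t1 t2, E s) →
    (∀ᵐ t : ℝ, t ∈ Ioo (0:ℝ) T → ∀ e : ℝ, 0 < e → e ≤ 1 → E t < e → Y t ≤ K * e ^ (1 + η)) →
    ∀ t, P t → Te ≤ t → t < T → Y t = 0 := by
  set ρ : ℝ := (1/2 : ℝ) ^ η with hρ
  have hρ0 : 0 < ρ := by positivity
  have hρ1 : ρ < 1 := Real.rpow_lt_one (by norm_num) (by norm_num) hη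
  have hL : ∀ k : ℕ, ((1/2 : ℝ) ^ k) ^ (1 + η) = (1/2) ^ k * ρ ^ k := fun k => by
    rw [Real.rpow_add (by positivity), Real.rpow_one, hρ, ← Real.rpow_natCast, ← Real.rpow_natCast,
      ← Real.rpow_mul (by norm_num), ← Real.rpow_mul (by norm_num), mul_comm η]
  have hs : ∀ k : ℕ, ∑ j ∈ Finset.range k, ρ ^ j ≤ 1 / (1 - ρ) := fun k => by
    rw [le_div_iff₀ (by linarith), mul_comm, mul_neg_geom_sum]
    linarith [pow_pos hρ0 k]
  refine ⟨Ym + 2 * K * (1 / (1 - ρ)) + 1, ?_, ?_⟩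
  · have : 0 < 1 / (1 - ρ) := by apply one_div_pos.mpr; linarith
    positivity
  intro T Y E P hP hY hYM hE hEi hen hfn t hPt hTe htT
  have claim : ∀ k : ℕ, ∀ t, P t → Ym + 2 * K * (∑ j ∈ Finset.range k, ρ ^ j) < t → t < T →
      Y t ≤ K * ((1/2 : ℝ) ^ k) ^ (1 + η) := by
    intro k
    induction k with
    | zero =>
      intro t h1 h2 h3
      refine ode_step hP hY hE hEi hen hfn le_rfl hYm (fun s _ _ _ => hYM s) (by positivity)
        (by norm_num) ?_ h3 h1
      simpa using h2
    | succ k ih =>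
      intro t h1 h2 h3
      have hp : 0 ≤ ∑ j ∈ Finset.range k, ρ ^ j := Finset.sum_nonneg fun j _ => by positivity
      refine ode_step hP hY hE hEi hen hfn (a := Ym + 2 * K * (∑ j ∈ Finset.range k, ρ ^ j))
        (by positivity) (B := K * ((1/2 : ℝ) ^ k) ^ (1 + η)) (by positivity) ih (by positivity)
        (pow_le_one₀ (by norm_num) (by norm_num)) ?_ h3 h1
      rw [hL]
      have e1 : K * ((1 / 2) ^ k * ρ ^ k) / (1 / 2 : ℝ) ^ (k + 1) = 2 * K * ρ ^ k := by
        rw [pow_succ]; field_simp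
      rw [e1]
      rw [Finset.sum_range_succ] at h2
      linarith
  have hb : ∀ k : ℕ, Y t ≤ K * (1/2 : ℝ) ^ k := fun k => by
    refine (claim k t hPt ?_ htT).trans ?_
    · have := mul_le_mul_of_nonneg_left (hs k) (by positivity : 0 ≤ 2 * K)
      linarith
    · rw [hL]
      have : ρ ^ k ≤ 1 := pow_le_one₀ hρ0.le hρ1.le
      refine mul_le_mul_of_nonneg_left ?_ hK.le
      exact mul_le_of_le_one_right (by positivity) this
  have lim : Filter.Tendsto (fun k : ℕ => K * (1/2 : ℝ) ^ k) Filter.atTop (nhds (K * 0)) :=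
    (tendsto_pow_atTop_nhds_zero_of_lt_one (by norm_num) (by norm_num)).const_mul K
  have := ge_of_tendsto' lim hb
  rw [mul_zero] at this
  exact le_antisymm this (hY t)

lemma ind_fubini {N : ℕ} {f : ℝ × EuclideanSpace ℝ (Fin N) → ℝ} (hf : Integrable f) (t1 t2 : ℝ) :
    ∫ z, (Ioo t1 t2).indicator (fun _ => (1:ℝ)) z.1 * f z = ∫ s in Ioo t1 t2, ∫ x, f (s, x) := by
  have e : (fun z : ℝ × EuclideanSpace ℝ (Fin N) => (Ioo t1 t2).indicator (fun _ => (1:ℝ)) z.1 * f z)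
      = (Ioo t1 t2 ×ˢ univ).indicator f := by
    ext z
    by_cases h : z.1 ∈ Ioo t1 t2
    · rw [indicator_of_mem h, indicator_of_mem (by exact ⟨h, mem_univ _⟩), one_mul]
    · rw [indicator_of_notMem h, indicator_of_notMem (fun hh => h hh.1), zero_mul]
  rw [e, integral_indicator (measurableSet_Ioo.prod MeasurableSet.univ)]
  have := setIntegral_prod (μ := volume) (ν := volume) (s := Ioo t1 t2) (t := univ) f hf.integrableOn
  simp only [Measure.restrict_univ] at this
  exact this

lemma conv_ineq {m a b : ℝ} (hm : 1 < m) (ha : 0 ≤ a) (hb : 0 ≤ b) :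
    b ^ (m + 1) / (m + 1) - a ^ (m + 1) / (m + 1) ≤ (b - a) * b ^ m := by
  have hpq : (m + 1).HolderConjugate ((m + 1) / m) := by
    rw [Real.holderConjugate_iff]
    refine ⟨by linarith, ?_⟩
    field_simp
    ring
  have h := Real.young_inequality_of_nonneg ha (Real.rpow_nonneg hb m) hpq
  rw [← Real.rpow_mul hb, mul_div_cancel₀ _ (by linarith)] at h
  have e : b ^ (m + 1) = b * b ^ m := by
    rw [Real.rpow_add_of_nonneg hb (by linarith) zero_le_one, Real.rpow_one, mul_comm]
  have e2 : b ^ (m + 1) / ((m + 1) / m) = b ^ (m + 1) - b ^ (m + 1) / (m + 1) := by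
    field_simp
    ring
  rw [e2] at h
  rw [sub_mul, ← e]
  linarith

lemma main_T {N : ℕ} (hN : 1 ≤ N) {m q σ : ℝ} (hm : 1 < m) (hq0 : 0 < q) (hq1 : q < 1)
    (hσ0 : 0 < σ) (hσ : σ < 2 * (1 - q) / (m - 1)) {C R : ℝ} (hC : 0 < C) :
    ∃ Te : ℝ, 0 < Te ∧ ∀ (T : ℝ) (U : ℝ × EuclideanSpace ℝ (Fin N) → ℝ)
      (G : Fin N → ℝ × EuclideanSpace ℝ (Fin N) → ℝ),
      Measurable U → (∀ z, 0 ≤ U z) → (∀ z, U z ≤ C) → (∀ s x, s ∉ Ioo (0:ℝ) T → U (s, x) = 0) →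
      (∀ s x, R ≤ ‖x‖ → U (s, x) = 0) →
      (∀ i, Measurable (G i)) → (∀ i, MemLp (G i) 2) → (∀ i s x, R ≤ ‖x‖ → G i (s, x) = 0) →
      (∀ i, ∀ ζ : ℝ × EuclideanSpace ℝ (Fin N) → ℝ, ContDiff ℝ 1 ζ → HasCompactSupport ζ →
      (∀ s x, s ∉ Ioo (0:ℝ) T → ζ (s, x) = 0) →
      ∫ z, U z ^ m * fderiv ℝ ζ z (0, EuclideanSpace.single i 1) = - ∫ z, G i z * ζ z) →
      (∀ ζ : ℝ × EuclideanSpace ℝ (Fin N) → ℝ, ContDiff ℝ 1 ζ → HasCompactSupport ζ →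
      (∀ s x, s ∉ Ioo (0:ℝ) T → ζ (s, x) = 0) →
      ∫ z, U z * fderiv ℝ ζ z (1, 0) =
        (∑ i, ∫ z, G i z * fderiv ℝ ζ z (0, EuclideanSpace.single i 1)) +
          ∫ z, (‖z.2‖ ^ σ * U z ^ q) * ζ z) →
      ∀ᵐ t : ℝ, Te ≤ t → t < T → ∀ᵐ x, U (t, x) = 0 := by
  have hm0 : 0 < m := by linarith
  have hm1 : 0 < m + 1 := by linarith
  set r : ℝ := (q + m) / m with hr
  set p : ℝ := (m + 1) / m with hp
  have hr0 : 0 < r := by positivity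
  have hr2 : r < 2 := by rw [hr, div_lt_iff₀ hm0]; linarith
  have hp1 : 1 < p := by rw [hp, lt_div_iff₀ hm0]; linarith
  have hp2 : p < 2 := by rw [hp, div_lt_iff₀ hm0]; linarith
  have hsp : (2 * σ + 2 * r) / (σ + 2) < p := by
    rw [lt_div_iff₀ (by linarith)] at hσ
    rw [div_lt_iff₀ (by linarith), hr, hp]
    have : (m + 1) / m * (σ + 2) - (2 * σ + 2 * ((q + m) / m)) =
      (2 * (1 - q) - σ * (m - 1)) / m := by field_simp; ring
    have h2 : 0 < (2 * (1 - q) - σ * (m - 1)) / m := div_pos (by linarith) hm0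
    linarith
  obtain ⟨K, η, hK, hη, hfn⟩ := func_ae (N := N) (R := R) (M := C ^ m) hN hσ0 hr0 hr2 hp1 hp2 hsp
    (by positivity)
  set Ym : ℝ := C ^ (m + 1) * volume.real (Metric.closedBall (0 : EuclideanSpace ℝ (Fin N)) R)
    with hYm
  have hYm0 : 0 ≤ Ym := by positivity
  obtain ⟨Te, hTe, hode⟩ := ode K η Ym hK hη hYm0
  refine ⟨Te, hTe, ?_⟩
  intro T U G hUm hU0 hUC hUT hUR hGm hG2 hGR hgrad heq
  have bl : ∀ b : ℝ, 0 < b → ∀ P : ENNReal, MemLp (fun z => U z ^ b) P := fun b hb P => by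
    refine bdd_memLp (C := C ^ b) (T := T) (R := R) (hUm.pow_const _) (fun z => ?_)
      (fun s x hs => ?_) (fun s x hx => ?_) P
    · rw [Real.norm_of_nonneg (Real.rpow_nonneg (hU0 z) _)]
      exact Real.rpow_le_rpow (hU0 z) (hUC z) hb.le
    · rw [hUT s x hs, Real.zero_rpow hb.ne']
    · rw [hUR s x hx, Real.zero_rpow hb.ne']
  have hU2 : MemLp U 2 := by
    have := bl 1 one_pos 2
    simpa only [Real.rpow_one] using this
  have hF2 : MemLp (fun z : ℝ × EuclideanSpace ℝ (Fin N) => ‖z.2‖ ^ σ * U z ^ q) 2 := by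
    refine bdd_memLp (f := fun z : ℝ × EuclideanSpace ℝ (Fin N) => ‖z.2‖ ^ σ * U z ^ q)
      (C := |R| ^ σ * C ^ q) (T := T) (R := R) ((measurable_snd.norm.pow_const _).mul
      (hUm.pow_const _)) (fun z => ?_) (fun s x hs => ?_) (fun s x hx => ?_) 2
    · by_cases hz : R ≤ ‖z.2‖
      · have hz1 : U z = 0 := hUR z.1 z.2 hz
        rw [hz1, Real.zero_rpow hq0.ne', mul_zero, norm_zero]
        positivity
      · push Not at hz
        rw [Real.norm_of_nonneg (mul_nonneg (by positivity) (Real.rpow_nonneg (hU0 z) _))]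
        exact mul_le_mul (Real.rpow_le_rpow (norm_nonneg _) (hz.le.trans (le_abs_self _)) hσ0.le)
          (Real.rpow_le_rpow (hU0 z) (hUC z) hq0.le) (Real.rpow_nonneg (hU0 z) _) (by positivity)
    · rw [hUT s x hs, Real.zero_rpow hq0.ne', mul_zero]
    · rw [hUR s x hx, Real.zero_rpow hq0.ne', mul_zero]
  set W : ℝ × EuclideanSpace ℝ (Fin N) → ℝ := fun z => U z ^ m with hW
  set y : ℝ × EuclideanSpace ℝ (Fin N) → ℝ := fun z => U z ^ (m + 1) / (m + 1) with hy
  have hWm : Measurable W := hUm.pow_const _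
  have hW2 : MemLp W 2 := bl m hm0 2
  have hWR : ∀ s x, R ≤ ‖x‖ → W (s, x) = 0 := fun s x hx => by
    simp only [hW]; rw [hUR s x hx, Real.zero_rpow hm0.ne']
  have hy1 : Integrable (fun z => U z ^ (m + 1)) := memLp_one_iff_integrable.mp (bl _ hm1 1)
  have hyi : Integrable y := hy1.div_const _
  have hy0 : ∀ z, 0 ≤ y z := fun z => div_nonneg (Real.rpow_nonneg (hU0 z) _) hm1.le
  have hym : Measurable y := (hUm.pow_const _).div_const _
  have hWp : ∀ z, W z ^ p = U z ^ (m + 1) := fun z => by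
    simp only [hW, hp]; rw [← Real.rpow_mul (hU0 z), mul_div_cancel₀ _ hm0.ne']
  have hWr : ∀ z, W z ^ r = U z ^ q * W z := fun z => by
    simp only [hW, hr]
    rw [← Real.rpow_mul (hU0 z), mul_div_cancel₀ _ hm0.ne',
      Real.rpow_add_of_nonneg (hU0 z) hq0.le hm0.le]
  set Y : ℝ → ℝ := fun t => ∫ x, y (t, x) with hY
  set E : ℝ → ℝ := fun t => (∑ i, ∫ x, G i (t, x) * G i (t, x)) + (∫ x, ‖x‖ ^ σ * W (t, x) ^ r)
    with hE
  have hGi : ∀ i, Integrable (fun z => G i z * G i z) := fun i => (hG2 i).integrable_mul (hG2 i)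
  have hFW : Integrable (fun z => ‖z.2‖ ^ σ * U z ^ q * W z) := hF2.integrable_mul hW2
  have hFWe : ∀ z : ℝ × EuclideanSpace ℝ (Fin N),
      ‖z.2‖ ^ σ * U z ^ q * W z = ‖z.2‖ ^ σ * W z ^ r := fun z => by rw [hWr]; ring
  simp only [hFWe] at hFW
  have hGt : ∀ i, Integrable (fun t => ∫ x, G i (t, x) * G i (t, x)) := fun i =>
    Integrable.integral_prod_left (hGi i)
  have hFt : Integrable (fun t => ∫ x, ‖x‖ ^ σ * W (t, x) ^ r) := Integrable.integral_prod_left hFW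
  have hGs : Integrable (fun t => ∑ i, ∫ x, G i (t, x) * G i (t, x)) :=
    integrable_finsetSum _ fun i _ => hGt i
  have hEi : Integrable E := hGs.add hFt
  have hYi : Integrable Y := Integrable.integral_prod_left hyi
  have hY0 : ∀ t, 0 ≤ Y t := fun t => integral_nonneg fun x => hy0 _
  have hYM : ∀ t, Y t ≤ Ym := fun t => by
    have hc : ∫ x, (Metric.closedBall (0 : EuclideanSpace ℝ (Fin N)) R).indicator
        (fun _ => C ^ (m + 1)) x = Ym := by
      rw [integral_indicator measurableSet_closedBall]
      simp [hYm, mul_comm]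
    rw [← hc]
    refine integral_mono_of_nonneg (ae_of_all _ fun x => hy0 _) ?_ (ae_of_all _ fun x => ?_)
    · rw [integrable_indicator_iff measurableSet_closedBall]
      exact integrableOn_const (measure_closedBall_lt_top.ne)
    · by_cases hx : x ∈ Metric.closedBall (0 : EuclideanSpace ℝ (Fin N)) R
      · rw [indicator_of_mem hx]
        refine (div_le_self (Real.rpow_nonneg (hU0 _) _) (by linarith)).trans ?_
        exact Real.rpow_le_rpow (hU0 _) (hUC _) hm1.le
      · rw [indicator_of_notMem hx]
        simp only [Metric.mem_closedBall, dist_zero_right, not_le] at hx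
        simp only [hy]
        rw [hUR t x hx.le, Real.zero_rpow hm1.ne', zero_div]
  have hE0 : ∀ t, 0 ≤ E t := fun t => add_nonneg
    (Finset.sum_nonneg fun i _ => integral_nonneg fun x => mul_self_nonneg _)
    (integral_nonneg fun x => mul_nonneg (by positivity)
      (Real.rpow_nonneg (Real.rpow_nonneg (hU0 _) _) _))
  have hder := LocallyIntegrable.ae_hasDerivAt_integral hYi.locallyIntegrable
  have fin := hode T Y E (fun t => HasDerivAt (fun x => ∫ s in (0:ℝ)..x, Y s) (Y t) t)
    (by filter_upwards [hder] with t ht _ using ht 0) hY0 hYM hE0 hEi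
    (by
      intro t1 t2 hd1 hd2 h0 h12 h2T
      have := energy (F := fun z => ‖z.2‖ ^ σ * U z ^ q) (y := y) hU2 hWm hW2 hF2 hWR hyi hGm hG2
        hgrad heq (fun z z' => conv_ineq hm (hU0 z) (hU0 z')) h0 h12 h2T hd1 hd2
      refine this.trans (le_of_eq ?_)
      congr 1
      simp only [hFWe]
      rw [ind_fubini hFW, Finset.sum_congr rfl fun i _ => ind_fubini (hGi i) t1 t2]
      rw [← integral_finsetSum _ fun i _ => (hGt i).integrableOn]
      rw [← integral_add hGs.integrableOn hFt.integrableOn])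
    (by
      filter_upwards [hfn T W G hWm hW2 (fun z => Real.rpow_nonneg (hU0 z) _)
        (fun z => Real.rpow_le_rpow (hU0 z) (hUC z) hm0.le) hWR hGm hG2 hGR hgrad] with
          t ht htT e he he1 hlt
      refine le_trans ?_ (ht htT e he he1 hlt)
      simp only [hWp]
      simp only [hY, hy]
      rw [integral_div]
      exact div_le_self (integral_nonneg fun x => Real.rpow_nonneg (hU0 _) _) (by linarith))
  have hys : ∀ᵐ t : ℝ, Integrable (fun x => y (t, x)) := Integrable.prod_right_ae hyi
  filter_upwards [hder, hys] with t hd hyt h1 h2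
  have h3 := fin t (hd 0) h1 h2
  have h4 := (integral_eq_zero_iff_of_nonneg (fun x => hy0 (t, x)) hyt).mp h3
  filter_upwards [h4] with x hx
  simp only [hy, Pi.zero_apply, div_eq_zero_iff, hm1.ne', or_false] at hx
  exact (Real.rpow_eq_zero (hU0 _) hm1.ne').mp hx

/-- **Theorem 1.2 (finite time extinction for σ < σ\*).**
Let `N ≥ 1`, `m > 1`, `q ∈ (0,1)` and `0 < σ < 2(1−q)/(m−1)`. Let `u₀ ∈ L^∞(ℝᴺ)` be
non-negative and let `u` be a non-negative weak solution of
`∂ₜ u = Δ(uᵐ) − |x|^σ u^q` with `u(0) = u₀`, whose support is localized in some ball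
`B(0,R)`.  Then `u` vanishes in finite time. -/
theorem finite_time_extinction_subcritical
    (N : ℕ) (hN : 1 ≤ N) (m q σ : ℝ) (hm : 1 < m) (hq0 : 0 < q) (hq1 : q < 1)
    (hσ0 : 0 < σ) (hσ : σ < 2 * (1 - q) / (m - 1))
    (u0 : EuclideanSpace ℝ (Fin N) → ℝ) (hu0 : IsBddNonneg N u0)
    (u : ℝ → EuclideanSpace ℝ (Fin N) → ℝ)
    (hu : IsWeakSolution N m q (fun x => ‖x‖ ^ σ) u0 u)
    (hloc : ∃ R : ℝ, 0 < R ∧ SupportLocalized N R u) :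
    VanishesInFiniteTime N u := by
  obtain ⟨R, hR, hloc⟩ := hloc
  obtain ⟨hu0m, hu00, C0, hu0C⟩ := hu0
  obtain ⟨hum, hun, ⟨C, huC⟩, g, hgm, hall⟩ := hu
  have hC : 0 ≤ C := (hun 0 0).trans (huC 0 0)
  obtain ⟨Te, hTe, H⟩ := main_T hN hm hq0 hq1 hσ0 hσ (C := C + 1) (R := R + 1) (by linarith)
  refine ⟨Te, hTe, ?_⟩
  have key : ∀ n : ℕ, ∀ᵐ t : ℝ, Te ≤ t → t < (n:ℝ) + 1 →
      ∀ᵐ x : EuclideanSpace ℝ (Fin N), u t x = 0 := by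
    intro n
    have hT : (0:ℝ) < (n:ℝ) + 1 := by positivity
    obtain ⟨h2, hgrad, heq⟩ := hall _ hT
    obtain ⟨U, G, a1, a2, a3, a4, a5, a6, a7, a8, a9, a10, a11⟩ := reduce hm hq0 hσ0 hT hu0m hu00
      hu0C hum hun huC hloc hgm h2 hgrad heq
    have hz := H _ U G a1 a2 (fun z => (a3 z).trans (by linarith)) a4 a5 a6 a7 a8 a9 a10
    filter_upwards [hz, a11] with t h1 h3 h4 h5
    filter_upwards [h1 h4 h5, h3 ⟨by linarith, h5⟩] with x hx1 hx2
    rw [hx2, hx1]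
  rw [← ae_all_iff] at key
  filter_upwards [key] with t ht h1
  obtain ⟨n, hn⟩ := exists_nat_gt t
  exact ht n h1 (by linarith)
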